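/- (Holonomic approximation by multi-sections, Theorem 7.2 of del Pino–Toussaint, stated over the n-torus in standard coordinates.) Fix integers n ≥ 1, ℓ ≥ 1, r ≥ 1 and a real ε > 0. Let (σ_0,…,σ_r) be a formal section of J^r over the n-torus, i.e. continuous ℤⁿ-periodic maps σ_i : ℝⁿ → Sym^i(ℝⁿ,ℝ^ℓ). Then there exists an r-jet tuple (X, ζ_0,…,ζ_r) of smooth maps on ℝⁿ such that: (a) the tuple is ℤⁿ-equivariant; (b) the tuple is integral; (c) the set {p ∈ ℝⁿ : fderiv ℝ X p is a linear isomorphism} is dense in ℝⁿ; (d) the front p ↦ (X p, ζ_0 p) is injective modulo ℤⁿ; (e) for all p ∈ ℝⁿ, ‖X p − p‖ < ε and ‖ζ_i p − σ_i p‖ < ε for every 0 ≤ i ≤ r. -/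

import Mathlib

/- `ℝⁿ` in standard coordinates. -/
noncomputable section

abbrev Vec (n : ℕ) := Fin n → ℝ

/-- The ambient space of `Sym^i(ℝⁿ, ℝ^ℓ)`: continuous `i`-multilinear maps `(ℝⁿ)^i → ℝ^ℓ`. -/
abbrev SymMap (n ℓ i : ℕ) := ContinuousMultilinearMap ℝ (fun _ : Fin i => Vec n) (Vec ℓ)

/-- A multilinear map is symmetric if it is invariant under permutations of its arguments. -/
def IsSymmMap {n ℓ i : ℕ} (A : SymMap n ℓ i) : Prop :=
  ∀ (e : Equiv.Perm (Fin i)) (v : Fin i → Vec n), A (v ∘ e) = A v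

/-- The inclusion `ℤⁿ → ℝⁿ`. -/
def zcast {n : ℕ} (m : Fin n → ℤ) : Vec n := fun j => (m j : ℝ)

section helpers
open scoped ContDiff

inductive Osc : (ℕ → ℝ → ℝ) → Prop
  | const (c : ℝ) : Osc (fun _ _ => c)
  | kap : Osc (fun N _ => (N : ℝ)⁻¹)
  | sin1 : Osc (fun _ t => Real.sin (2 * Real.pi * t))
  | cos1 : Osc (fun _ t => Real.cos (2 * Real.pi * t))
  | sinN : Osc (fun N t => Real.sin (2 * Real.pi * N * t))
  | cosN : Osc (fun N t => Real.cos (2 * Real.pi * N * t))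
  | add {f g : ℕ → ℝ → ℝ} : Osc f → Osc g → Osc (fun N t => f N t + g N t)
  | mul {f g : ℕ → ℝ → ℝ} : Osc f → Osc g → Osc (fun N t => f N t * g N t)

theorem Osc.contDiff {f : ℕ → ℝ → ℝ} (hf : Osc f) (N : ℕ) : ContDiff ℝ ω (f N) := by
  induction hf with
  | const c => exact contDiff_const
  | kap => exact contDiff_const
  | sin1 => exact Real.contDiff_sin.comp (contDiff_const.mul contDiff_id)
  | cos1 => exact Real.contDiff_cos.comp (contDiff_const.mul contDiff_id)
  | sinN => exact Real.contDiff_sin.comp (contDiff_const.mul contDiff_id)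
  | cosN => exact Real.contDiff_cos.comp (contDiff_const.mul contDiff_id)
  | add _ _ h1 h2 => exact h1.add h2
  | mul _ _ h1 h2 => exact h1.mul h2

theorem Osc.periodic {f : ℕ → ℝ → ℝ} (hf : Osc f) (N : ℕ) (t : ℝ) : f N (t + 1) = f N t := by
  induction hf with
  | const c => rfl
  | kap => rfl
  | sin1 => simp only [mul_add, mul_one]; exact Real.sin_add_two_pi _
  | cos1 => simp only [mul_add, mul_one]; exact Real.cos_add_two_pi _
  | sinN =>
    have := Real.sin_add_nat_mul_two_pi (2 * Real.pi * N * t) N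
    beta_reduce; rw [← this]; congr 1; ring
  | cosN =>
    have := Real.cos_add_nat_mul_two_pi (2 * Real.pi * N * t) N
    beta_reduce; rw [← this]; congr 1; ring
  | add _ _ h1 h2 => simp only [h1, h2]
  | mul _ _ h1 h2 => simp only [h1, h2]

theorem Osc.bdd {f : ℕ → ℝ → ℝ} (hf : Osc f) : ∃ B, 0 ≤ B ∧ ∀ N ≥ 1, ∀ t, |f N t| ≤ B := by
  induction hf with
  | const c => exact ⟨|c|, abs_nonneg _, fun _ _ _ => le_rfl⟩
  | kap =>
    refine ⟨1, zero_le_one, fun N hN _ => ?_⟩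
    rw [abs_of_nonneg (by positivity)]
    exact inv_le_one_of_one_le₀ (by exact_mod_cast hN)
  | sin1 => exact ⟨1, zero_le_one, fun _ _ _ => Real.abs_sin_le_one _⟩
  | cos1 => exact ⟨1, zero_le_one, fun _ _ _ => Real.abs_cos_le_one _⟩
  | sinN => exact ⟨1, zero_le_one, fun _ _ _ => Real.abs_sin_le_one _⟩
  | cosN => exact ⟨1, zero_le_one, fun _ _ _ => Real.abs_cos_le_one _⟩
  | add _ _ h1 h2 =>
    obtain ⟨B1, hB1, h1⟩ := h1
    obtain ⟨B2, hB2, h2⟩ := h2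
    exact ⟨B1 + B2, by positivity, fun N hN t =>
      (abs_add_le _ _).trans (add_le_add (h1 N hN t) (h2 N hN t))⟩
  | mul _ _ h1 h2 =>
    obtain ⟨B1, hB1, h1⟩ := h1
    obtain ⟨B2, hB2, h2⟩ := h2
    exact ⟨B1 * B2, by positivity, fun N hN t => by
      rw [abs_mul]; exact mul_le_mul (h1 N hN t) (h2 N hN t) (abs_nonneg _) hB1⟩

theorem Osc.deriv {f : ℕ → ℝ → ℝ} (hf : Osc f) :
    ∃ g, Osc g ∧ ∀ N ≥ 1, ∀ t, HasDerivAt (f N) (N * g N t) t := by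
  have hN0 : ∀ N : ℕ, N ≥ 1 → (N : ℝ) ≠ 0 := fun N hN => by
    have : (N:ℝ) ≥ 1 := by exact_mod_cast hN
    linarith
  have hl : ∀ (a t : ℝ), HasDerivAt (fun t => a * t) a t := fun a t => by
    simpa using (hasDerivAt_id t).const_mul a
  induction hf with
  | const c => exact ⟨_, .const 0, fun N _ t => by simpa using hasDerivAt_const t c⟩
  | kap => exact ⟨_, .const 0, fun N _ t => by simpa using hasDerivAt_const t _⟩
  | sin1 =>
    refine ⟨_, .mul (.mul .kap (.const (2 * Real.pi))) .cos1, fun N hN t => ?_⟩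
    convert (hl (2 * Real.pi) t).sin using 1
    field_simp [hN0 N hN]
  | cos1 =>
    refine ⟨_, .mul (.mul .kap (.const (-(2 * Real.pi)))) .sin1, fun N hN t => ?_⟩
    convert (hl (2 * Real.pi) t).cos using 1
    field_simp [hN0 N hN]
  | sinN =>
    refine ⟨_, .mul (.const (2 * Real.pi)) .cosN, fun N hN t => ?_⟩
    convert (hl (2 * Real.pi * N) t).sin using 1
    ring
  | cosN =>
    refine ⟨_, .mul (.const (-(2 * Real.pi))) .sinN, fun N hN t => ?_⟩
    convert (hl (2 * Real.pi * N) t).cos using 1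
    ring
  | add _ _ h1 h2 =>
    obtain ⟨g1, o1, h1⟩ := h1
    obtain ⟨g2, o2, h2⟩ := h2
    refine ⟨_, .add o1 o2, fun N hN t => ?_⟩
    exact ((h1 N hN t).add (h2 N hN t)).congr_deriv (by ring)
  | @mul f1 f2 i1 i2 h1 h2 =>
    obtain ⟨g1, o1, h1⟩ := h1
    obtain ⟨g2, o2, h2⟩ := h2
    refine ⟨_, .add (.mul o1 i2) (.mul i1 o2), fun N hN t => ?_⟩
    exact ((h1 N hN t).mul (h2 N hN t)).congr_deriv (by ring)

theorem Osc.pow {f : ℕ → ℝ → ℝ} (hf : Osc f) (k : ℕ) : Osc (fun N t => f N t ^ k) := by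
  induction k with
  | zero => simpa using Osc.const 1
  | succ k ih => simpa only [pow_succ] using ih.mul hf

theorem Osc.jets {V : ℕ → ℝ → ℝ} (hV : Osc V) (M : ℕ) : ∀ {W : ℕ → ℝ → ℝ}, Osc W →
    ∃ U : ℕ → ℕ → ℝ → ℝ, (∀ m, Osc (U m)) ∧ (∀ N t, U 0 N t = V N t ^ (2 * M + 1) * W N t) ∧
      ∀ m < M, ∀ N ≥ 1, ∀ t, HasDerivAt (U m N) (N * (V N t * U (m + 1) N t)) t := by
  induction M with
  | zero =>
    intro W hW
    exact ⟨fun _ N t => V N t ^ 1 * W N t, fun _ => (hV.pow 1).mul hW, fun N t => by simp,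
      fun m hm => absurd hm (by omega)⟩
  | succ M ih =>
    intro W hW
    obtain ⟨V', oV', dV⟩ := hV.deriv
    obtain ⟨W', oW', dW⟩ := hW.deriv
    obtain ⟨U, oU, hU0, hU⟩ := ih (W := fun N t => (2 * M + 3 : ℝ) * V' N t * W N t + V N t * W' N t)
      ((((Osc.const (2 * M + 3 : ℝ)).mul oV').mul hW).add (hV.mul oW'))
    refine ⟨fun m => match m with
      | 0 => fun N t => V N t ^ (2 * (M + 1) + 1) * W N t
      | m + 1 => U m, ?_, fun N t => rfl, ?_⟩
    · intro m
      cases m with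
      | zero => exact (hV.pow _).mul hW
      | succ m => exact oU m
    · intro m hm N hN t
      cases m with
      | zero =>
        simp only [hU0]
        refine (((dV N hN t).pow (2 * (M + 1) + 1)).mul (dW N hN t)).congr_deriv ?_
        simp only [Pi.pow_apply]
        push_cast
        ring
      | succ m => exact hU m (by omega) N hN t


structure JetT (M : ℕ) (Q : ℝ → ℝ) (T : ℕ → ℝ → ℝ) : Prop where
  smooth : ∀ m ≤ M + 1, ContDiff ℝ ∞ (T m)
  der : ∀ m ≤ M, ∀ t, HasDerivAt (T m) (deriv Q t * T (m + 1) t) t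
  per : ∀ m, 1 ≤ m → m ≤ M + 1 → ∀ t, T m (t + 1) = T m t

def tower (V W : ℕ → ℝ → ℝ) (U : ℕ → ℕ → ℝ → ℝ) (M N : ℕ) (c : ℝ) : ℕ → ℝ → ℝ
  | 0 => fun t => c * ∫ s in (0:ℝ)..t, V N s ^ (2 * M + 2) * W N s
  | m + 1 => fun t => c / N * U m N t

theorem primitive_contDiff {f : ℝ → ℝ} (hf : ContDiff ℝ ∞ f) :
    ContDiff ℝ ∞ (fun t => ∫ s in (0:ℝ)..t, f s) := by
  have hd : ∀ t, HasDerivAt (fun t => ∫ s in (0:ℝ)..t, f s) (f t) t := fun t =>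
    intervalIntegral.integral_hasDerivAt_right (hf.continuous.intervalIntegrable _ _)
      hf.continuous.aestronglyMeasurable.stronglyMeasurableAtFilter hf.continuous.continuousAt
  rw [contDiff_infty_iff_deriv]
  refine ⟨fun t => (hd t).differentiableAt, ?_⟩
  have : deriv (fun t => ∫ s in (0:ℝ)..t, f s) = f := funext fun t => (hd t).deriv
  rw [this]; exact hf

theorem Osc.smooth {f : ℕ → ℝ → ℝ} (hf : Osc f) (N : ℕ) : ContDiff ℝ ∞ (f N) :=
  (hf.contDiff N).of_le le_top

theorem tower_jet {V W : ℕ → ℝ → ℝ} {U : ℕ → ℕ → ℝ → ℝ} {M : ℕ} (hV : Osc V) (hW : Osc W)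
    (hU : ∀ m, Osc (U m)) (hU0 : ∀ N t, U 0 N t = V N t ^ (2 * M + 1) * W N t)
    (hUd : ∀ m < M, ∀ N ≥ 1, ∀ t, HasDerivAt (U m N) (N * (V N t * U (m + 1) N t)) t)
    (N : ℕ) (hN : 1 ≤ N) (c : ℝ) (Q : ℝ → ℝ) (hQ : ∀ t, deriv Q t = N * V N t) :
    JetT M Q (tower V W U M N c) := by
  have hN0 : (N : ℝ) ≠ 0 := by positivity
  have hF : ContDiff ℝ ∞ (fun s => V N s ^ (2 * M + 2) * W N s) :=
    ((hV.smooth N).pow _).mul (hW.smooth N)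
  refine ⟨?_, ?_, ?_⟩
  · rintro (_ | m) hm
    · exact contDiff_const.mul (primitive_contDiff hF)
    · exact contDiff_const.mul ((hU m).smooth N)
  · rintro (_ | m) hm t
    · have := (intervalIntegral.integral_hasDerivAt_right (a := 0) (b := t)
        (hF.continuous.intervalIntegrable _ _)
        hF.continuous.aestronglyMeasurable.stronglyMeasurableAtFilter
        hF.continuous.continuousAt).const_mul c
      refine this.congr_deriv ?_
      simp only [tower, hQ, hU0]
      field_simp
      ring
    · refine ((hUd m (by omega) N hN t).const_mul (c / N)).congr_deriv ?_
      simp only [tower, hQ]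
      ring
  · rintro (_ | m) h1 hm t
    · omega
    · simp only [tower, (hU m).periodic]

theorem tower_shift {V W : ℕ → ℝ → ℝ} {U : ℕ → ℕ → ℝ → ℝ} {M : ℕ} (hV : Osc V) (hW : Osc W)
    (N : ℕ) (c : ℝ) (t : ℝ) :
    tower V W U M N c 0 (t + 1) = tower V W U M N c 0 t +
      c * ∫ s in (0:ℝ)..1, V N s ^ (2 * M + 2) * W N s := by
  have hF : Continuous (fun s => V N s ^ (2 * M + 2) * W N s) :=
    (((hV.smooth N).pow _).mul (hW.smooth N)).continuous
  have hp : Function.Periodic (fun s => V N s ^ (2 * M + 2) * W N s) 1 := fun s => by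
    simp only [hV.periodic, hW.periodic]
  have h1 := intervalIntegral.integral_add_adjacent_intervals
    (hF.intervalIntegrable (μ := MeasureTheory.volume) 0 t) (hF.intervalIntegrable t (t + 1))
  have h2 := hp.intervalIntegral_add_eq t 0
  simp only [zero_add] at h2
  simp only [tower, ← mul_add]
  rw [← h1, h2]

/-- a nondecreasing function with `T (t+1) = T t + 1`, `T 0 = 0` is within 1 of identity -/
theorem near_id {T : ℝ → ℝ} (hm : Monotone T) (h0 : T 0 = 0) (h1 : ∀ t, T (t + 1) = T t + 1)
    (t : ℝ) : |T t - t| ≤ 1 := by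
  have hp : Function.Periodic (fun t => T t - t) 1 := fun t => by simp only [h1]; ring
  have e : T t - t = T (Int.fract t) - Int.fract t := by
    have := hp.sub_int_mul_eq (x := t) ⌊t⌋
    simp only [mul_one] at this
    rw [← this]; rfl
  have a := hm (Int.fract_nonneg t)
  have b := hm (Int.fract_lt_one t).le
  have c := h1 0
  have d1 := Int.fract_nonneg t
  have d2 := Int.fract_lt_one t
  rw [zero_add] at c
  rw [e, abs_le]; constructor <;> linarith

theorem tower_mono {V W : ℕ → ℝ → ℝ} {U : ℕ → ℕ → ℝ → ℝ} {M : ℕ} (hV : Osc V) (hW : Osc W)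
    (N : ℕ) {c : ℝ} (hc : 0 ≤ c) (hpos : ∀ t, 0 ≤ W N t) :
    Monotone (tower V W U M N c 0) := by
  have hF : Continuous (fun s => V N s ^ (2 * M + 2) * W N s) :=
    (((hV.smooth N).pow _).mul (hW.smooth N)).continuous
  intro a b hab
  have h1 := intervalIntegral.integral_add_adjacent_intervals
    (hF.intervalIntegrable (μ := MeasureTheory.volume) 0 a) (hF.intervalIntegrable a b)
  have h2 : 0 ≤ ∫ s in a..b, V N s ^ (2 * M + 2) * W N s :=
    intervalIntegral.integral_nonneg hab fun s _ => by
      have : V N s ^ (2 * M + 2) = (V N s ^ (M + 1)) ^ 2 := by ring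
      rw [this]; exact mul_nonneg (sq_nonneg _) (hpos s)
  simp only [tower]
  apply mul_le_mul_of_nonneg_left _ hc
  linarith

theorem scale_jet {M : ℕ} {Q : ℝ → ℝ} {T : ℕ → ℝ → ℝ} (h : JetT M Q T) (hQ : ContDiff ℝ ∞ Q)
    (L : ℕ) (hL : 1 ≤ L) (A : ℝ) (hA : A ≠ 0) :
    JetT M (fun t => A * Q (L * t)) (fun m t => (A ^ m)⁻¹ * (L : ℝ)⁻¹ * T m (L * t)) := by
  have hL0 : (L : ℝ) ≠ 0 := by positivity
  have hl : ∀ t : ℝ, HasDerivAt (fun t : ℝ => (L : ℝ) * t) L t := fun t => by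
    simpa using (hasDerivAt_id t).const_mul (L : ℝ)
  refine ⟨?_, ?_, ?_⟩
  · intro m hm
    exact contDiff_const.mul ((h.smooth m hm).comp (contDiff_const.mul contDiff_id))
  · intro m hm t
    have h1 := ((h.der m hm (L * t)).comp t (hl t)).const_mul ((A ^ m)⁻¹ * (L : ℝ)⁻¹)
    have h2 := (((hQ.differentiable (by simp)).differentiableAt (x := L * t)).hasDerivAt.comp t
      (hl t)).const_mul A
    refine h1.congr_deriv ?_
    have h3 : deriv (fun t => A * Q (L * t)) t = A * (deriv Q (L * t) * L) := h2.deriv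
    rw [h3]
    field_simp
    ring
  · intro m h1 hm t
    have hp : Function.Periodic (T m) 1 := h.per m h1 hm
    have := hp.nat_mul L ((L : ℝ) * t)
    simp only [mul_one] at this
    simp only [mul_add, mul_one, this]

theorem shift_nat {T : ℝ → ℝ} (h : ∀ t, T (t + 1) = T t + 1) (L : ℕ) (t : ℝ) :
    T (t + L) = T t + L := by
  have hp : Function.Periodic (fun t => T t - t) 1 := fun t => by simp only [h]; ring
  have := hp.nat_mul L t
  simp only [mul_one] at this
  linarith

/-- wiggle data -/
theorem wig (M : ℕ) (A η : ℝ) (hA : 0 < A) (hη : 0 < η) : ∃ (Q : ℝ → ℝ) (T : ℕ → ℝ → ℝ),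
    ContDiff ℝ ∞ Q ∧ JetT M Q T ∧ (∀ t, Q (t + 1) = Q t) ∧ (∀ t, T 0 (t + 1) = T 0 t + 1) ∧
    (∀ t, |Q t| ≤ A) ∧ (∀ t, |T 0 t - t| ≤ η) ∧
    (∀ m, 1 ≤ m → m ≤ M + 1 → ∀ t, |T m t| ≤ η) := by
  have oV := Osc.cos1
  obtain ⟨U, oU, hU0, hUd⟩ := oV.jets M (Osc.const 1)
  set I := ∫ s in (0:ℝ)..1, Real.cos (2 * Real.pi * s) ^ (2 * M + 2) * 1 with hI
  have hc : Continuous fun s => Real.cos (2 * Real.pi * s) ^ (2 * M + 2) * 1 := by fun_prop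
  have hnn : ∀ s, 0 ≤ Real.cos (2 * Real.pi * s) ^ (2 * M + 2) * 1 := fun s => by
    have : Real.cos (2 * Real.pi * s) ^ (2 * M + 2) * 1 = (Real.cos (2 * Real.pi * s) ^ (M + 1)) ^ 2 := by
      ring
    rw [this]; positivity
  have hIpos : 0 < I := by
    apply intervalIntegral.integral_pos one_pos hc.continuousOn (fun s _ => hnn s)
    exact ⟨0, by simp, by simp⟩
  set Q0 : ℝ → ℝ := fun t => Real.sin (2 * Real.pi * t) * (2 * Real.pi)⁻¹ with hQ0
  have dQ0 : ∀ t, HasDerivAt Q0 (Real.cos (2 * Real.pi * t)) t := fun t => by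
    have := ((((hasDerivAt_id t).const_mul (2 * Real.pi))).sin).mul_const (2 * Real.pi)⁻¹
    refine this.congr_deriv ?_
    simp only [id]
    field_simp
  have sQ0 : ContDiff ℝ ∞ Q0 := by fun_prop
  have jT := tower_jet oV (Osc.const 1) oU hU0 hUd 1 le_rfl I⁻¹ Q0
    (fun t => by rw [(dQ0 t).deriv]; simp)
  set T0 := tower (fun _ t => Real.cos (2 * Real.pi * t)) (fun _ _ => 1) U M 1 I⁻¹ with hT0
  have sh : ∀ t, T0 0 (t + 1) = T0 0 t + 1 := fun t => by
    rw [hT0, tower_shift oV (Osc.const 1) 1 I⁻¹ t]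
    rw [← hI, inv_mul_cancel₀ hIpos.ne']
  have mono : Monotone (T0 0) := tower_mono oV (Osc.const 1) 1 (inv_nonneg.2 hIpos.le)
    (fun _ => zero_le_one)
  have z0 : T0 0 0 = 0 := by simp [hT0, tower]
  have nid := near_id mono z0 sh
  have hb : ∃ B : ℝ, 1 ≤ B ∧ ∀ m, 1 ≤ m → m ≤ M + 1 → ∀ t, |(A ^ m)⁻¹ * T0 m t| ≤ B := by
    choose b hb0 hb using fun m => (oU m).bdd
    refine ⟨1 + ∑ m ∈ Finset.range (M + 2), |(A ^ m)⁻¹| * (|I⁻¹| * b (m - 1)), ?_, ?_⟩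
    · have : 0 ≤ ∑ m ∈ Finset.range (M + 2), |(A ^ m)⁻¹| * (|I⁻¹| * b (m - 1)) :=
        Finset.sum_nonneg fun m _ => by have := hb0 (m - 1); positivity
      linarith
    · intro m h1 hm t
      have h2 : |(A ^ m)⁻¹| * (|I⁻¹| * b (m - 1)) ≤
          ∑ m ∈ Finset.range (M + 2), |(A ^ m)⁻¹| * (|I⁻¹| * b (m - 1)) :=
        Finset.single_le_sum (f := fun m => |(A ^ m)⁻¹| * (|I⁻¹| * b (m - 1)))
          (fun m _ => by have := hb0 (m - 1); positivity) (Finset.mem_range.2 (by omega))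
      obtain ⟨k, rfl⟩ : ∃ k, m = k + 1 := ⟨m - 1, by omega⟩
      have h3 : |T0 (k + 1) t| ≤ |I⁻¹| * b k := by
        simp only [hT0, tower, Nat.cast_one, div_one, abs_mul]
        exact mul_le_mul_of_nonneg_left (hb k 1 le_rfl t) (abs_nonneg _)
      rw [abs_mul]
      have := mul_le_mul_of_nonneg_left h3 (abs_nonneg ((A ^ (k+1))⁻¹))
      simp only [Nat.add_sub_cancel] at h2
      linarith
  obtain ⟨B, hB1, hB⟩ := hb
  obtain ⟨L, hL⟩ := exists_nat_gt (B / η)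
  have hL0 : (0:ℝ) < L := lt_of_le_of_lt (by positivity) hL
  have hL1 : 1 ≤ L := by exact_mod_cast hL0
  have hBL : (L:ℝ)⁻¹ * B ≤ η := by
    rw [div_lt_iff₀ hη] at hL
    rw [inv_mul_le_iff₀ hL0]; linarith
  refine ⟨_, _, ?_, scale_jet jT sQ0 L hL1 A hA.ne', ?_, ?_, ?_, ?_, ?_⟩
  · fun_prop
  · intro t
    have := Real.sin_add_nat_mul_two_pi (2 * Real.pi * (L * t)) L
    simp only [hQ0]
    rw [← this]; congr 3; ring
  · intro t
    simp only [pow_zero, inv_one, one_mul, mul_add, mul_one]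
    rw [shift_nat sh]; field_simp
  · intro t
    rw [abs_mul, abs_of_pos hA]
    have : |Q0 (L * t)| ≤ 1 := by
      simp only [hQ0, abs_mul]
      have h1 := Real.abs_sin_le_one (2 * Real.pi * (L * t))
      have h2 : |(2 * Real.pi)⁻¹| ≤ 1 := by
        rw [abs_of_pos (by positivity)]
        exact inv_le_one_of_one_le₀ (by linarith [Real.pi_gt_three])
      exact mul_le_one₀ h1 (abs_nonneg _) h2
    nlinarith
  · intro t
    have e : (A ^ 0)⁻¹ * (L:ℝ)⁻¹ * T0 0 (L * t) - t = (L:ℝ)⁻¹ * (T0 0 (L * t) - L * t) := by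
      field_simp
    rw [e, abs_mul, abs_of_pos (inv_pos.2 hL0)]
    refine le_trans (mul_le_mul_of_nonneg_left ((nid _).trans hB1) (by positivity)) hBL
  · intro m h1 hm t
    have e : (A ^ m)⁻¹ * (L:ℝ)⁻¹ * T0 m (L * t) = (L:ℝ)⁻¹ * ((A ^ m)⁻¹ * T0 m (L * t)) := by ring
    rw [e, abs_mul, abs_of_pos (inv_pos.2 hL0)]
    exact le_trans (mul_le_mul_of_nonneg_left (hB m h1 hm _) (by positivity)) hBL


def zQ (N : ℕ) (t : ℝ) : ℝ :=
  t + Real.sin (2 * Real.pi * t) ^ 2 * Real.sin (2 * Real.pi * N * t) / 8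

def zV (N : ℕ) (t : ℝ) : ℝ :=
  (N : ℝ)⁻¹ * (1 + Real.pi / 2 * Real.sin (2 * Real.pi * t) * Real.cos (2 * Real.pi * t) *
    Real.sin (2 * Real.pi * N * t)) +
  Real.pi / 4 * Real.sin (2 * Real.pi * t) ^ 2 * Real.cos (2 * Real.pi * N * t)

theorem zV_osc : Osc zV := by
  have := (Osc.kap.mul ((Osc.const 1).add ((((Osc.const (Real.pi / 2)).mul Osc.sin1).mul
    Osc.cos1).mul Osc.sinN))).add
    (((Osc.const (Real.pi / 4)).mul (Osc.sin1.pow 2)).mul Osc.cosN)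
  exact this

theorem zQ_deriv (N : ℕ) (hN : 1 ≤ N) (t : ℝ) : HasDerivAt (zQ N) (N * zV N t) t := by
  have hN0 : (N : ℝ) ≠ 0 := by positivity
  have hl : ∀ (a t : ℝ), HasDerivAt (fun t => a * t) a t := fun a t => by
    simpa using (hasDerivAt_id t).const_mul a
  have := (hasDerivAt_id t).add (((((hl (2 * Real.pi) t).sin).pow 2).mul
    ((hl (2 * Real.pi * N) t).sin)).div_const 8)
  refine this.congr_deriv ?_
  simp only [zV, Pi.pow_apply]
  field_simp
  ring

theorem zQ_smooth (N : ℕ) : ContDiff ℝ ∞ (zQ N) := by unfold zQ; fun_prop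

theorem zQ_shift (N : ℕ) (t : ℝ) : zQ N (t + 1) = zQ N t + 1 := by
  have h1 := Osc.sin1.periodic N t
  have h2 := Osc.sinN.periodic N t
  beta_reduce at h1 h2
  simp only [zQ, h1, h2]; ring

theorem zQ_near (N : ℕ) (t : ℝ) : |zQ N t - t| ≤ 1 := by
  have h1 := Real.abs_sin_le_one (2 * Real.pi * t)
  have h2 := Real.abs_sin_le_one (2 * Real.pi * N * t)
  have : zQ N t - t = Real.sin (2 * Real.pi * t) ^ 2 * Real.sin (2 * Real.pi * N * t) / 8 := by
    simp only [zQ]; ring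
  rw [this, abs_div, abs_mul, abs_pow]
  have h3 : |Real.sin (2 * Real.pi * t)| ^ 2 ≤ 1 := pow_le_one₀ (abs_nonneg _) h1
  have := mul_le_one₀ h3 (abs_nonneg _) h2
  rw [abs_of_pos (by norm_num : (0:ℝ) < 8)]
  linarith

theorem zQ_floor (N : ℕ) (s : ℝ) : ⌊2 * zQ N s⌋ = ⌊2 * s⌋ := by
  set k := ⌊2 * s⌋ with hk
  set v := s - k / 2 with hv
  have hv0 : 0 ≤ v := by have := Int.floor_le (2 * s); rw [hv]; linarith
  have hv1 : v < 1 / 2 := by have := Int.lt_floor_add_one (2 * s); rw [hv]; linarith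
  have e1 : Real.sin (2 * Real.pi * s) ^ 2 = Real.sin (2 * Real.pi * v) ^ 2 := by
    have : 2 * Real.pi * v = 2 * Real.pi * s - k * Real.pi := by rw [hv]; ring
    have h2 : ((-1:ℝ)^k)^2 = 1 := by
      rcases Int.even_or_odd k with h|h <;> simp [h.neg_one_zpow]
    rw [this, Real.sin_sub_int_mul_pi, mul_pow, h2, one_mul]
  have hs : |Real.sin (2 * Real.pi * v)| ≤ 1 := Real.abs_sin_le_one _
  have b1 : |Real.sin (2 * Real.pi * v)| ≤ 2 * Real.pi * v := by
    have := Real.abs_sin_le_abs (x := 2 * Real.pi * v)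
    rwa [abs_of_nonneg (by positivity : 0 ≤ 2 * Real.pi * v)] at this
  have b2 : |Real.sin (2 * Real.pi * v)| ≤ 2 * Real.pi * (1 / 2 - v) := by
    have e : Real.sin (2 * Real.pi * v) = Real.sin (2 * Real.pi * (1 / 2 - v)) := by
      rw [← Real.sin_pi_sub]; congr 1; ring
    rw [e]
    have := Real.abs_sin_le_abs (x := 2 * Real.pi * (1 / 2 - v))
    rwa [abs_of_nonneg (by have := Real.pi_pos; have : 0 < 1/2 - v := by linarith
                           positivity : 0 ≤ 2 * Real.pi * (1 / 2 - v))] at this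
  have hpi := Real.pi_lt_four
  have hsq : Real.sin (2 * Real.pi * v) ^ 2 ≤ |Real.sin (2 * Real.pi * v)| := by
    rw [← sq_abs]; nlinarith [abs_nonneg (Real.sin (2 * Real.pi * v))]
  have hd : |zQ N s - s| ≤ Real.sin (2 * Real.pi * v) ^ 2 / 8 := by
    have : zQ N s - s = Real.sin (2 * Real.pi * s) ^ 2 * Real.sin (2 * Real.pi * N * s) / 8 := by
      simp only [zQ]; ring
    rw [this, e1, abs_div, abs_mul, abs_of_nonneg (sq_nonneg _),
      abs_of_pos (by norm_num : (0:ℝ) < 8)]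
    have := mul_le_mul_of_nonneg_left (Real.abs_sin_le_one (2 * Real.pi * N * s))
      (sq_nonneg (Real.sin (2 * Real.pi * v)))
    linarith
  rw [abs_le] at hd
  rw [Int.floor_eq_iff]
  have hs' : s = v + k / 2 := by rw [hv]; ring
  constructor
  · nlinarith
  · nlinarith

theorem zV_lower (M : ℕ) : ∃ c0 > 0, ∃ N0 : ℕ, ∀ N ≥ N0,
    c0 ≤ ∫ s in (0:ℝ)..1, zV N s ^ (2 * M + 2) * Real.sin (2 * Real.pi * s) ^ 2 := by
  refine ⟨(1/64) ^ (M + 1) / 8, by positivity, 100, fun N hN => ?_⟩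
  have hN' : (100:ℝ) ≤ N := by exact_mod_cast hN
  have hVc : Continuous (zV N) := (zV_osc.smooth N).continuous
  have hκ : (N:ℝ)⁻¹ ≤ 1 / 100 := by
    rw [inv_le_comm₀ (by linarith) (by norm_num)]; simpa using hN'
  have hκ0 : 0 < (N:ℝ)⁻¹ := by positivity
  have hFc : Continuous fun s => zV N s ^ (2 * M + 2) * Real.sin (2 * Real.pi * s) ^ 2 := by fun_prop
  have hnn : ∀ s, 0 ≤ zV N s ^ (2 * M + 2) * Real.sin (2 * Real.pi * s) ^ 2 := fun s => by
    have : zV N s ^ (2 * M + 2) * Real.sin (2 * Real.pi * s) ^ 2 =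
      (zV N s ^ (M + 1) * Real.sin (2 * Real.pi * s)) ^ 2 := by ring
    rw [this]; positivity
  have step1 : ∫ s in (1/8:ℝ)..(3/8), zV N s ^ (2 * M + 2) * Real.sin (2 * Real.pi * s) ^ 2 ≤
      ∫ s in (0:ℝ)..1, zV N s ^ (2 * M + 2) * Real.sin (2 * Real.pi * s) ^ 2 :=
    intervalIntegral.integral_mono_interval (by norm_num) (by norm_num) (by norm_num)
      (Filter.Eventually.of_forall hnn) (hFc.intervalIntegrable _ _)
  refine le_trans ?_ step1
  have hsin : ∀ s ∈ Set.Icc (1/8:ℝ) (3/8), 1 / 2 ≤ Real.sin (2 * Real.pi * s) ^ 2 := by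
    intro s hs
    have : Real.sin (2 * Real.pi * s) ^ 2 = 1 / 2 - Real.cos (2 * (2 * Real.pi * s)) / 2 := by
      rw [Real.cos_two_mul]; nlinarith [Real.sin_sq_add_cos_sq (2 * Real.pi * s)]
    rw [this]
    have : Real.cos (2 * (2 * Real.pi * s)) ≤ 0 := by
      apply Real.cos_nonpos_of_pi_div_two_le_of_le
      · nlinarith [Real.pi_pos, hs.1]
      · nlinarith [Real.pi_pos, hs.2]
    linarith
  have hV2 : ∀ s ∈ Set.Icc (1/8:ℝ) (3/8),
      Real.cos (2 * Real.pi * N * s) ^ 2 / 16 - 9 / 10000 ≤ zV N s ^ 2 := by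
    intro s hs
    set x := Real.pi / 4 * Real.sin (2 * Real.pi * s) ^ 2 * Real.cos (2 * Real.pi * N * s) with hx
    set a := 1 + Real.pi / 2 * Real.sin (2 * Real.pi * s) * Real.cos (2 * Real.pi * s) *
      Real.sin (2 * Real.pi * N * s) with ha
    have e : zV N s = (N:ℝ)⁻¹ * a + x := rfl
    have ha3 : |a| ≤ 3 := by
      have h1 : |Real.sin (2 * Real.pi * s) * Real.cos (2 * Real.pi * s) *
        Real.sin (2 * Real.pi * N * s)| ≤ 1 := by
        rw [abs_mul, abs_mul]
        exact mul_le_one₀ (mul_le_one₀ (Real.abs_sin_le_one _) (abs_nonneg _)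
          (Real.abs_cos_le_one _)) (abs_nonneg _) (Real.abs_sin_le_one _)
      have h2 : a = 1 + Real.pi / 2 * (Real.sin (2 * Real.pi * s) * Real.cos (2 * Real.pi * s) *
        Real.sin (2 * Real.pi * N * s)) := by rw [ha]; ring
      rw [h2]
      rw [abs_le] at h1 ⊢
      have := Real.pi_lt_four
      have := Real.pi_pos
      constructor <;> nlinarith
    have hka : ((N:ℝ)⁻¹ * a) ^ 2 ≤ 9 / 10000 := by
      rw [← sq_abs, abs_mul, abs_of_pos hκ0]
      have : (N:ℝ)⁻¹ * |a| ≤ 1 / 100 * 3 := mul_le_mul hκ ha3 (abs_nonneg _) (by norm_num)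
      have h0 : 0 ≤ (N:ℝ)⁻¹ * |a| := by positivity
      nlinarith
    have hx2 : Real.cos (2 * Real.pi * N * s) ^ 2 / 8 ≤ x ^ 2 := by
      have h1 : 3/8 ≤ Real.pi / 4 * Real.sin (2 * Real.pi * s) ^ 2 := by
        nlinarith [hsin s hs, Real.pi_gt_three]
      have h2 : 1/8 ≤ (Real.pi / 4 * Real.sin (2 * Real.pi * s) ^ 2) ^ 2 := by nlinarith
      rw [hx, mul_pow]
      nlinarith [sq_nonneg (Real.cos (2 * Real.pi * N * s))]
    rw [e]
    nlinarith [sq_nonneg (2 * ((N:ℝ)⁻¹ * a) + x)]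
  have hcos : 1/10 ≤ ∫ s in (1/8:ℝ)..(3/8), Real.cos (2 * Real.pi * N * s) ^ 2 := by
    have h1 : ∀ s, HasDerivAt (fun s => s / 2 + Real.sin (2 * (2 * Real.pi * N) * s) / (8 * Real.pi * N))
        (Real.cos (2 * Real.pi * N * s) ^ 2) s := by
      intro s
      have hl : ∀ (a t : ℝ), HasDerivAt (fun t => a * t) a t := fun a t => by
        simpa using (hasDerivAt_id t).const_mul a
      have := ((hasDerivAt_id s).div_const 2).add
        (((hl (2 * (2 * Real.pi * N)) s).sin).div_const (8 * Real.pi * N))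
      refine this.congr_deriv ?_
      have e : 2 * (2 * Real.pi * N) * s = 2 * (2 * Real.pi * N * s) := by ring
      rw [e, Real.cos_two_mul]
      field_simp
      ring
    rw [intervalIntegral.integral_eq_sub_of_hasDerivAt (fun s _ => h1 s)
      (Continuous.intervalIntegrable (by fun_prop) _ _)]
    have hb : ∀ y, |Real.sin y / (8 * Real.pi * N)| ≤ 1 / 2400 := by
      intro y
      have hp : 2400 ≤ 8 * Real.pi * N := by nlinarith [Real.pi_gt_three]
      rw [abs_div, abs_of_pos (by linarith : 0 < 8 * Real.pi * N)]
      exact div_le_div₀ zero_le_one (Real.abs_sin_le_one _) (by norm_num) hp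
    have b1 := abs_le.1 (hb (2 * (2 * Real.pi * N) * (3/8)))
    have b2 := abs_le.1 (hb (2 * (2 * Real.pi * N) * (1/8)))
    linarith [b1.1, b2.2]
  have hpt : ∀ s ∈ Set.Icc (1/8:ℝ) (3/8),
      (1/64) ^ (M + 1) / 2 + (M + 1) * (1/64) ^ M / 2 *
        (Real.cos (2 * Real.pi * N * s) ^ 2 / 16 - 9 / 10000 - 1/64) ≤
      zV N s ^ (2 * M + 2) * Real.sin (2 * Real.pi * s) ^ 2 := by
    intro s hs
    have hb := one_add_mul_le_pow (a := 64 * zV N s ^ 2 - 1) (by nlinarith [sq_nonneg (zV N s)]) (M + 1)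
    have e : zV N s ^ (2 * M + 2) = (1/64) ^ (M + 1) * (1 + (64 * zV N s ^ 2 - 1)) ^ (M + 1) := by
      rw [← mul_pow]; ring
    have hp : (0:ℝ) < (1/64) ^ M := by positivity
    have h1 : (1/64) ^ (M + 1) + (M + 1) * (1/64) ^ M * (zV N s ^ 2 - 1/64) ≤ zV N s ^ (2 * M + 2) := by
      rw [e]
      have := mul_le_mul_of_nonneg_left hb (by positivity : (0:ℝ) ≤ (1/64) ^ (M + 1))
      push_cast at this
      refine le_trans (le_of_eq ?_) this
      rw [pow_succ]; ring
    have h2 : (M + 1) * (1/64) ^ M * (Real.cos (2 * Real.pi * N * s) ^ 2 / 16 - 9 / 10000 - 1/64) ≤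
        (M + 1) * (1/64) ^ M * (zV N s ^ 2 - 1/64) :=
      mul_le_mul_of_nonneg_left (by linarith [hV2 s hs]) (by positivity)
    have h3 : 0 ≤ zV N s ^ (2 * M + 2) := by
      have : zV N s ^ (2 * M + 2) = (zV N s ^ (M + 1)) ^ 2 := by ring
      rw [this]; positivity
    nlinarith [hsin s hs]
  have hmono := intervalIntegral.integral_mono_on (μ := MeasureTheory.volume) (a := 1/8) (b := 3/8)
    (by norm_num) (Continuous.intervalIntegrable (by fun_prop) _ _) (hFc.intervalIntegrable _ _) hpt
  refine le_trans ?_ hmono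
  rw [intervalIntegral.integral_add (by simp) (Continuous.intervalIntegrable (by fun_prop) _ _),
    intervalIntegral.integral_const_mul, intervalIntegral.integral_sub
      (Continuous.intervalIntegrable (by fun_prop) _ _) (by simp), intervalIntegral.integral_sub
      (Continuous.intervalIntegrable (by fun_prop) _ _) (by simp)]
  have hdv : ∫ s in (1/8:ℝ)..(3/8), Real.cos (2 * Real.pi * N * s) ^ 2 / 16 =
      (∫ s in (1/8:ℝ)..(3/8), Real.cos (2 * Real.pi * N * s) ^ 2) / 16 :=
    intervalIntegral.integral_div _ _
  rw [hdv]
  simp only [intervalIntegral.integral_const, smul_eq_mul]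
  have hp : 0 ≤ ((M:ℝ) + 1) * (1/64) ^ M / 2 := by positivity
  have hq : 0 ≤ (∫ s in (1/8:ℝ)..(3/8), Real.cos (2 * Real.pi * N * s) ^ 2) / 16 -
    (3/8 - 1/8) * (9/10000) - (3/8 - 1/8) * (1/64) := by linarith
  nlinarith [mul_nonneg hp hq]

theorem zV_even (N : ℕ) (t : ℝ) : zV N (-t) = zV N t := by
  simp only [zV, mul_neg, Real.sin_neg, Real.cos_neg]; ring

theorem zVsin_int (M N : ℕ) :
    ∫ s in (0:ℝ)..1, zV N s ^ (2 * M + 2) * Real.sin (2 * Real.pi * s) = 0 := by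
  set F : ℝ → ℝ := fun s => zV N s ^ (2 * M + 2) * Real.sin (2 * Real.pi * s) with hF
  have h1 : ∀ s, F (1 - s) = - F s := fun s => by
    have p : Function.Periodic F 1 := fun s => by
      have := Osc.sin1.periodic N s
      beta_reduce at this
      simp only [hF, zV_osc.periodic, this]
    have : F (1 - s) = F (-s) := by rw [← p (-s)]; congr 1; ring
    rw [this]; simp only [hF, zV_even, mul_neg, Real.sin_neg]
  have h2 := intervalIntegral.integral_comp_sub_left (a := 0) (b := 1) F 1
  simp only [h1, intervalIntegral.integral_neg, sub_self, sub_zero] at h2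
  linarith

theorem zV_dense {M N : ℕ}
    (hI : 0 < ∫ s in (0:ℝ)..1, zV N s ^ (2 * M + 2) * Real.sin (2 * Real.pi * s) ^ 2)
    {U : Set ℝ} (hU : IsOpen U) (hne : U.Nonempty) :
    ∃ x ∈ U, zV N x * Real.sin (2 * Real.pi * x) ≠ 0 := by
  by_contra hcon
  push Not at hcon
  obtain ⟨x, hx⟩ := hne
  have hA : AnalyticOnNhd ℝ (fun x => zV N x * Real.sin (2 * Real.pi * x)) Set.univ := by
    rw [← contDiff_omega_iff_analyticOnNhd]
    exact (zV_osc.mul Osc.sin1).contDiff N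
  have h0 : (fun x => zV N x * Real.sin (2 * Real.pi * x)) = fun _ => 0 := by
    apply AnalyticOnNhd.eq_of_eventuallyEq hA analyticOnNhd_const (z₀ := x)
    filter_upwards [hU.mem_nhds hx] with y hy using hcon y hy
  have : ∀ s, zV N s ^ (2 * M + 2) * Real.sin (2 * Real.pi * s) ^ 2 = 0 := fun s => by
    have e : zV N s ^ (2 * M + 2) * Real.sin (2 * Real.pi * s) ^ 2 =
      zV N s ^ (2 * M) * (zV N s * Real.sin (2 * Real.pi * s)) ^ 2 := by ring
    rw [e, congrFun h0 s]; simp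
  simp [this] at hI

theorem zig_sep {M N : ℕ}
    (hI : 0 < ∫ s in (0:ℝ)..1, zV N s ^ (2 * M + 2) * Real.sin (2 * Real.pi * s) ^ 2)
    {s t : ℝ} (hst : s < t) (hQ : zQ N s = zQ N t) :
    |∫ x in s..t, zV N x ^ (2 * M + 2) * Real.sin (2 * Real.pi * x) ^ 2| ≤
      |∫ x in s..t, zV N x ^ (2 * M + 2) * Real.sin (2 * Real.pi * x)| ∧
    0 < |∫ x in s..t, zV N x ^ (2 * M + 2) * Real.sin (2 * Real.pi * x)| := by
  have hfl : ⌊2 * s⌋ = ⌊2 * t⌋ := by rw [← zQ_floor N s, ← zQ_floor N t, hQ]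
  set k := ⌊2 * s⌋ with hk
  have hVc : Continuous (zV N) := (zV_osc.smooth N).continuous
  have hsg : ∀ x ∈ Set.Icc s t, 0 ≤ (-1:ℝ) ^ k * Real.sin (2 * Real.pi * x) := by
    intro x hx
    have e : (-1:ℝ) ^ k * Real.sin (2 * Real.pi * x) = Real.sin (2 * Real.pi * x - k * Real.pi) :=
      (Real.sin_sub_int_mul_pi _ _).symm
    rw [e]
    have a1 : (k:ℝ) ≤ 2 * s := Int.floor_le _
    have a2 : 2 * t < k + 1 := by rw [hfl]; exact Int.lt_floor_add_one _
    apply Real.sin_nonneg_of_nonneg_of_le_pi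
    · nlinarith [Real.pi_pos, hx.1]
    · nlinarith [Real.pi_pos, hx.2]
  have h2 : ((-1:ℝ)^k)^2 = 1 := by
    rcases Int.even_or_odd k with h|h <;> simp [h.neg_one_zpow]
  have habs : |(-1:ℝ)^k| = 1 := by
    rcases Int.even_or_odd k with h|h <;> simp [h.neg_one_zpow]
  have hpw : ∀ x, 0 ≤ zV N x ^ (2 * M + 2) := fun x => by
    have : zV N x ^ (2 * M + 2) = (zV N x ^ (M + 1)) ^ 2 := by ring
    rw [this]; positivity
  have e1 : |∫ x in s..t, zV N x ^ (2 * M + 2) * Real.sin (2 * Real.pi * x)| =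
      |∫ x in s..t, zV N x ^ (2 * M + 2) * ((-1:ℝ)^k * Real.sin (2 * Real.pi * x))| := by
    have : ∀ x, zV N x ^ (2 * M + 2) * ((-1:ℝ)^k * Real.sin (2 * Real.pi * x)) =
      (-1:ℝ)^k * (zV N x ^ (2 * M + 2) * Real.sin (2 * Real.pi * x)) := fun x => by ring
    simp only [this, intervalIntegral.integral_const_mul, abs_mul, habs, one_mul]
  have hc1 : Continuous fun x => zV N x ^ (2 * M + 2) * ((-1:ℝ)^k * Real.sin (2 * Real.pi * x)) := by
    fun_prop
  have hc2 : Continuous fun x => zV N x ^ (2 * M + 2) * Real.sin (2 * Real.pi * x) ^ 2 := by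
    fun_prop
  have hle : ∀ x ∈ Set.Icc s t, Real.sin (2 * Real.pi * x) ^ 2 ≤
      (-1:ℝ)^k * Real.sin (2 * Real.pi * x) := by
    intro x hx
    have a := hsg x hx
    have b : (-1:ℝ)^k * Real.sin (2 * Real.pi * x) ≤ 1 := by
      refine (le_abs_self _).trans ?_
      rw [abs_mul, habs, one_mul]; exact Real.abs_sin_le_one _
    have c : Real.sin (2 * Real.pi * x) ^ 2 = ((-1:ℝ)^k * Real.sin (2 * Real.pi * x)) ^ 2 := by
      rw [mul_pow, h2, one_mul]
    rw [c]; nlinarith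
  have hmono := intervalIntegral.integral_mono_on (μ := MeasureTheory.volume) hst.le
    (hc2.intervalIntegrable _ _) (hc1.intervalIntegrable _ _)
    (fun x hx => mul_le_mul_of_nonneg_left (hle x hx) (hpw x))
  have hpos : 0 < ∫ x in s..t, zV N x ^ (2 * M + 2) * Real.sin (2 * Real.pi * x) ^ 2 := by
    obtain ⟨x, hx, hx0⟩ := zV_dense hI isOpen_Ioo (Set.nonempty_Ioo.2 hst)
    refine intervalIntegral.integral_pos hst hc2.continuousOn
      (fun y _ => mul_nonneg (hpw y) (sq_nonneg _)) ⟨x, Set.Ioo_subset_Icc_self hx, ?_⟩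
    have e : zV N x ^ (2 * M + 2) * Real.sin (2 * Real.pi * x) ^ 2 =
      (zV N x ^ M * (zV N x * Real.sin (2 * Real.pi * x))) ^ 2 := by ring
    have : zV N x ≠ 0 := fun h => hx0 (by simp [h])
    rw [e]; positivity
  rw [e1, abs_of_pos hpos, abs_of_pos (lt_of_lt_of_le hpos hmono)]
  exact ⟨hmono, lt_of_lt_of_le hpos hmono⟩

theorem zig_unit (M : ℕ) (C : ℝ) (hC : 0 ≤ C) : ∃ B : ℝ, 1 ≤ B ∧ ∀ η > 0,
    ∃ (Q : ℝ → ℝ) (T S : ℕ → ℝ → ℝ),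
    ContDiff ℝ ∞ Q ∧ JetT M Q T ∧ JetT M Q S ∧ (∀ t, Q (t + 1) = Q t + 1) ∧
    (∀ t, T 0 (t + 1) = T 0 t + 1) ∧ (∀ t, S 0 (t + 1) = S 0 t) ∧
    (∀ t, |Q t - t| ≤ 1) ∧ (∀ t, |T 0 t - t| ≤ 1) ∧ (∀ t, |S 0 t| ≤ B) ∧
    (∀ m, 1 ≤ m → m ≤ M + 1 → ∀ t, |T m t| ≤ η) ∧
    (∀ m, 1 ≤ m → m ≤ M + 1 → ∀ t, |S m t| ≤ η) ∧
    Dense {t | deriv Q t ≠ 0} ∧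
    (∀ s t, s ≠ t → Q s = Q t → C * |T 0 s - T 0 t| < |S 0 s - S 0 t|) := by
  obtain ⟨c0, hc0, N0, hlow⟩ := zV_lower M
  obtain ⟨U, oU, hU0, hUd⟩ := zV_osc.jets M (Osc.sin1.pow 2)
  obtain ⟨Y, oY, hY0, hYd⟩ := zV_osc.jets M Osc.sin1
  choose bu hbu0 hbu using fun m => (oU m).bdd
  choose by' hby0 hby using fun m => (oY m).bdd
  obtain ⟨bF, hbF0, hbF⟩ := ((zV_osc.pow (2 * M + 2)).mul Osc.sin1).bdd
  refine ⟨1 + (C + 1) / c0 * bF, by have : 0 ≤ (C + 1) / c0 * bF := by positivity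
                                    linarith, fun η hη => ?_⟩
  set K := ∑ m ∈ Finset.range (M + 1), (C + 1) / c0 * (bu m + by' m) with hK
  have hKm : ∀ m ≤ M, (C + 1) / c0 * (bu m + by' m) ≤ K := fun m hm =>
    Finset.single_le_sum (f := fun m => (C + 1) / c0 * (bu m + by' m))
      (fun m _ => by have := hbu0 m; have := hby0 m; positivity) (Finset.mem_range.2 (by omega))
  obtain ⟨N1, hN1⟩ := exists_nat_gt (K / η)
  set N := max 1 (max N0 N1) with hNdef
  have hN : 1 ≤ N := le_max_left _ _
  have hNp : (0:ℝ) < N := by positivity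
  have hNK : K / N ≤ η := by
    have h1 : (N1:ℝ) ≤ N := by exact_mod_cast (le_max_right N0 N1).trans (le_max_right _ _)
    rw [div_lt_iff₀ hη] at hN1
    rw [div_le_iff₀ hNp]; nlinarith
  have hI := hlow N ((le_max_left N0 N1).trans (le_max_right _ _))
  set I := ∫ s in (0:ℝ)..1, zV N s ^ (2 * M + 2) * Real.sin (2 * Real.pi * s) ^ 2 with hIdef
  have hI0 : 0 < I := lt_of_lt_of_le hc0 hI
  have hQd : ∀ t, deriv (zQ N) t = N * zV N t := fun t => (zQ_deriv N hN t).deriv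
  have jT := tower_jet zV_osc (Osc.sin1.pow 2) oU hU0 hUd N hN I⁻¹ (zQ N) hQd
  have jS := tower_jet zV_osc Osc.sin1 oY hY0 hYd N hN ((C + 1) / I) (zQ N) hQd
  have hcI : (C + 1) / I ≤ (C + 1) / c0 := by gcongr
  have hcI0 : 0 ≤ (C + 1) / I := by positivity
  have hiI : I⁻¹ ≤ (C + 1) / c0 := by
    refine le_trans ?_ hcI
    rw [inv_eq_one_div]; gcongr; linarith
  set T := tower zV (fun _ t => Real.sin (2 * Real.pi * t) ^ 2) U M N I⁻¹ with hT
  set S := tower zV (fun _ t => Real.sin (2 * Real.pi * t)) Y M N ((C + 1) / I) with hS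
  have shT : ∀ t, T 0 (t + 1) = T 0 t + 1 := fun t => by
    rw [hT, tower_shift zV_osc (Osc.sin1.pow 2) N I⁻¹ t, ← hIdef, inv_mul_cancel₀ hI0.ne']
  have shS : ∀ t, S 0 (t + 1) = S 0 t := fun t => by
    rw [hS, tower_shift zV_osc Osc.sin1 N _ t, zVsin_int]; simp
  have mono : Monotone (T 0) := tower_mono zV_osc (Osc.sin1.pow 2) N (inv_nonneg.2 hI0.le)
    (fun _ => sq_nonneg _)
  have z0 : T 0 0 = 0 := by simp [hT, tower]
  have hFc : Continuous fun s => zV N s ^ (2 * M + 2) * Real.sin (2 * Real.pi * s) :=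
    (((zV_osc.pow (2 * M + 2)).mul Osc.sin1).smooth N).continuous
  have hGc : Continuous fun s => zV N s ^ (2 * M + 2) * Real.sin (2 * Real.pi * s) ^ 2 :=
    (((zV_osc.pow (2 * M + 2)).mul (Osc.sin1.pow 2)).smooth N).continuous
  refine ⟨zQ N, T, S, zQ_smooth N, jT, jS, zQ_shift N, shT, shS, zQ_near N, near_id mono z0 shT,
    ?_, ?_, ?_, ?_, ?_⟩
  · intro t
    have hp : Function.Periodic (S 0) 1 := shS
    have e : S 0 t = S 0 (Int.fract t) := by
      have := hp.sub_int_mul_eq (x := t) ⌊t⌋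
      simp only [mul_one] at this
      rw [← this]; rfl
    rw [e]
    have h1 : |∫ s in (0:ℝ)..Int.fract t, zV N s ^ (2 * M + 2) * Real.sin (2 * Real.pi * s)| ≤ bF := by
      have := intervalIntegral.norm_integral_le_of_norm_le_const (a := 0) (b := Int.fract t)
        (f := fun s => zV N s ^ (2 * M + 2) * Real.sin (2 * Real.pi * s)) (C := bF)
        (fun x _ => hbF N hN x)
      rw [Real.norm_eq_abs, sub_zero, abs_of_nonneg (Int.fract_nonneg t)] at this
      nlinarith [Int.fract_lt_one t, Int.fract_nonneg t]
    have h2 : |S 0 (Int.fract t)| = (C + 1) / I *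
        |∫ s in (0:ℝ)..Int.fract t, zV N s ^ (2 * M + 2) * Real.sin (2 * Real.pi * s)| := by
      rw [← abs_of_nonneg hcI0, ← abs_mul]; rfl
    rw [h2]
    have := mul_le_mul hcI h1 (abs_nonneg _) (by positivity)
    linarith
  · rintro (_ | m) h1 hm t
    · omega
    · have h2 : |T (m + 1) t| = I⁻¹ / N * |U m N t| := by
        simp only [hT, tower, abs_mul]; rw [abs_of_pos (by positivity : 0 < I⁻¹ / N)]
      rw [h2]
      have h3 : I⁻¹ * |U m N t| ≤ (C + 1) / c0 * (bu m + by' m) :=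
        mul_le_mul hiI ((hbu m N hN t).trans (by linarith [hby0 m])) (abs_nonneg _) (by positivity)
      refine le_trans ?_ hNK
      rw [div_mul_eq_mul_div]
      exact div_le_div_of_nonneg_right (h3.trans (hKm m (by omega))) hNp.le
  · rintro (_ | m) h1 hm t
    · omega
    · have h2 : |S (m + 1) t| = (C + 1) / I / N * |Y m N t| := by
        simp only [hS, tower, abs_mul]; rw [abs_of_pos (by positivity : 0 < (C + 1) / I / N)]
      rw [h2]
      have h3 : (C + 1) / I * |Y m N t| ≤ (C + 1) / c0 * (bu m + by' m) :=
        mul_le_mul hcI ((hby m N hN t).trans (by linarith [hbu0 m])) (abs_nonneg _) (by positivity)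
      refine le_trans ?_ hNK
      rw [div_mul_eq_mul_div]
      exact div_le_div_of_nonneg_right (h3.trans (hKm m (by omega))) hNp.le
  · rw [dense_iff_inter_open]
    intro O hO hne
    obtain ⟨x, hx, hx0⟩ := zV_dense hI0 hO hne
    refine ⟨x, hx, ?_⟩
    simp only [Set.mem_ofPred_eq, hQd]
    exact mul_ne_zero hNp.ne' (fun h => hx0 (by simp [h]))
  · have key : ∀ s t, s < t → zQ N s = zQ N t → C * |T 0 s - T 0 t| < |S 0 s - S 0 t| := by
      intro s t hst hQ
      obtain ⟨a, b⟩ := zig_sep hI0 hst hQ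
      have eT : |T 0 s - T 0 t| = I⁻¹ *
          |∫ x in s..t, zV N x ^ (2 * M + 2) * Real.sin (2 * Real.pi * x) ^ 2| := by
        have := intervalIntegral.integral_interval_sub_left
          (hGc.intervalIntegrable (μ := MeasureTheory.volume) 0 t) (hGc.intervalIntegrable 0 s)
        rw [← this, abs_sub_comm, ← abs_of_pos (inv_pos.2 hI0), ← abs_mul, mul_sub]; rfl
      have eS : |S 0 s - S 0 t| = (C + 1) / I *
          |∫ x in s..t, zV N x ^ (2 * M + 2) * Real.sin (2 * Real.pi * x)| := by
        have := intervalIntegral.integral_interval_sub_left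
          (hFc.intervalIntegrable (μ := MeasureTheory.volume) 0 t) (hFc.intervalIntegrable 0 s)
        rw [← this, abs_sub_comm, ← abs_of_nonneg hcI0, ← abs_mul, mul_sub]; rfl
      rw [eT, eS]
      have hii := inv_pos.2 hI0
      have e : (C + 1) / I = C * I⁻¹ + I⁻¹ := by rw [div_eq_mul_inv]; ring
      rw [e]
      have := mul_le_mul_of_nonneg_left a (by positivity : 0 ≤ C * I⁻¹)
      have := mul_pos hii b
      nlinarith
    intro s t hst hQ
    rcases lt_or_gt_of_ne hst with h | h
    · exact key s t h hQ
    · rw [abs_sub_comm, abs_sub_comm (S 0 s)]; exact key t s h hQ.symm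

/-- zig-zag data -/
theorem zig (M : ℕ) (C η δ : ℝ) (hC : 0 ≤ C) (hη : 0 < η) (hδ : 0 < δ) :
    ∃ (Q : ℝ → ℝ) (T S : ℕ → ℝ → ℝ),
    ContDiff ℝ ∞ Q ∧ JetT M Q T ∧ JetT M Q S ∧ (∀ t, Q (t + 1) = Q t + 1) ∧
    (∀ t, T 0 (t + 1) = T 0 t + 1) ∧ (∀ t, S 0 (t + 1) = S 0 t) ∧
    (∀ t, |Q t - t| ≤ δ) ∧ (∀ t, |T 0 t - t| ≤ δ) ∧ (∀ t, |S 0 t| ≤ η) ∧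
    (∀ m, 1 ≤ m → m ≤ M + 1 → ∀ t, |T m t| ≤ η) ∧
    (∀ m, 1 ≤ m → m ≤ M + 1 → ∀ t, |S m t| ≤ η) ∧
    Dense {t | deriv Q t ≠ 0} ∧
    (∀ s t, s ≠ t → Q s = Q t → C * |T 0 s - T 0 t| < |S 0 s - S 0 t|) := by
  obtain ⟨B, hB1, hB⟩ := zig_unit M C hC
  obtain ⟨L, hL⟩ := exists_nat_gt (max (1 / δ) (B / η))
  have hL1 : 1 / δ < L := (le_max_left _ _).trans_lt hL
  have hL2 : B / η < L := (le_max_right _ _).trans_lt hL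
  have hL0 : (0:ℝ) < L := lt_trans (by positivity) hL1
  have hLn : 1 ≤ L := by exact_mod_cast hL0
  have hLr : (1:ℝ) ≤ L := by exact_mod_cast hLn
  have hLδ : (L:ℝ)⁻¹ ≤ δ := by
    rw [div_lt_iff₀ hδ] at hL1
    rw [inv_le_iff_one_le_mul₀ hL0]; linarith
  have hLη : (L:ℝ)⁻¹ * B ≤ η := by
    rw [div_lt_iff₀ hη] at hL2
    rw [inv_mul_le_iff₀ hL0]; linarith
  obtain ⟨Q, T, S, sQ, jT, jS, shQ, shT, shS, nQ, nT, bS, bT', bS', dQ, sep⟩ :=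
    hB (η / (L:ℝ) ^ M) (by positivity)
  have hA : (L:ℝ)⁻¹ ≠ 0 := by positivity
  have hLi : 0 < (L:ℝ)⁻¹ := by positivity
  have hm' : ∀ (m : ℕ) (x : ℝ), 1 ≤ m → m ≤ M + 1 → |x| ≤ η / (L:ℝ) ^ M →
      |(((L:ℝ)⁻¹) ^ m)⁻¹ * (L:ℝ)⁻¹ * x| ≤ η := by
    intro m x h1 hm hx
    obtain ⟨k, rfl⟩ : ∃ k, m = k + 1 := ⟨m - 1, by omega⟩
    have e : (((L:ℝ)⁻¹) ^ (k + 1))⁻¹ * (L:ℝ)⁻¹ * x = (L:ℝ) ^ k * x := by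
      rw [inv_pow, inv_inv, pow_succ]; field_simp
    rw [e, abs_mul, abs_of_pos (by positivity)]
    rw [le_div_iff₀ (by positivity)] at hx
    have : (L:ℝ) ^ k ≤ (L:ℝ) ^ M := pow_le_pow_right₀ hLr (by omega)
    nlinarith [abs_nonneg x]
  have near : ∀ (F : ℝ → ℝ), (∀ t, |F t - t| ≤ 1) → ∀ t, |(L:ℝ)⁻¹ * F (L * t) - t| ≤ δ := by
    intro F hF t
    have e : (L:ℝ)⁻¹ * F (L * t) - t = (L:ℝ)⁻¹ * (F (L * t) - L * t) := by field_simp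
    rw [e, abs_mul, abs_of_pos hLi]
    nlinarith [hF (L * t)]
  refine ⟨_, _, _, ?_, scale_jet jT sQ L hLn _ hA, scale_jet jS sQ L hLn _ hA, ?_, ?_, ?_, ?_,
    ?_, ?_, ?_, ?_, ?_, ?_⟩
  · exact contDiff_const.mul (sQ.comp (contDiff_const.mul contDiff_id))
  · intro t
    simp only [mul_add, mul_one]
    rw [shift_nat shQ]; field_simp
  · intro t
    simp only [pow_zero, inv_one, one_mul, mul_add, mul_one]
    rw [shift_nat shT]; field_simp
  · intro t
    have hp : Function.Periodic (S 0) 1 := shS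
    have := hp.nat_mul L ((L : ℝ) * t)
    simp only [mul_one] at this
    simp only [mul_add, mul_one, this]
  · exact near Q nQ
  · intro t
    simpa only [pow_zero, inv_one, one_mul] using near (T 0) nT t
  · intro t
    simp only [pow_zero, inv_one, one_mul]
    rw [abs_mul, abs_of_pos hLi]
    exact le_trans (mul_le_mul_of_nonneg_left (bS _) hLi.le) hLη
  · intro m h1 hm t
    exact hm' m _ h1 hm (bT' m h1 hm _)
  · intro m h1 hm t
    exact hm' m _ h1 hm (bS' m h1 hm _)
  · have hd : ∀ t, deriv (fun t => (L:ℝ)⁻¹ * Q (L * t)) t = deriv Q (L * t) := by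
      intro t
      have hl : HasDerivAt (fun t : ℝ => (L : ℝ) * t) L t := by
        simpa using (hasDerivAt_id t).const_mul (L : ℝ)
      have h2 := (((sQ.differentiable (by simp)).differentiableAt (x := L * t)).hasDerivAt.comp t
        hl).const_mul (L:ℝ)⁻¹
      have h3 : deriv (fun t => (L:ℝ)⁻¹ * Q (L * t)) t = (L:ℝ)⁻¹ * (deriv Q (L * t) * L) := h2.deriv
      rw [h3]; field_simp
    simp only [hd]
    exact dQ.preimage (f := fun t => (L:ℝ) * t) (Homeomorph.mulLeft₀ (L:ℝ) hL0.ne').isOpenMap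
  · intro s t hst hQ
    have h1 : Q (L * s) = Q (L * t) := mul_left_cancel₀ hA hQ
    have h2 := sep (L * s) (L * t) (fun h => hst (mul_left_cancel₀ hL0.ne' h)) h1
    simp only [pow_zero, inv_one, one_mul]
    rw [← mul_sub, ← mul_sub, abs_mul, abs_mul, abs_of_pos hLi]
    nlinarith

set_option maxSynthPendingDepth 3
section calc1
variable {P E F V : Type*} [NormedAddCommGroup P] [NormedSpace ℝ P]
  [NormedAddCommGroup E] [NormedSpace ℝ E] [NormedAddCommGroup F] [NormedSpace ℝ F]
  [NormedAddCommGroup V] [NormedSpace ℝ V]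

abbrev cL (E V : Type*) [NormedAddCommGroup E] [NormedSpace ℝ E] [NormedAddCommGroup V]
    [NormedSpace ℝ V] (i : ℕ) :
    (E →L[ℝ] ContinuousMultilinearMap ℝ (fun _ : Fin i => E) V) ≃ₗᵢ[ℝ]
      ContinuousMultilinearMap ℝ (fun _ : Fin (i + 1) => E) V :=
  (continuousMultilinearCurryLeftEquiv ℝ (fun _ : Fin (i + 1) => E) V).symm

theorem iter_succ (f : E → V) (i : ℕ) (x : E) :
    iteratedFDeriv ℝ (i + 1) f x = cL E V i (fderiv ℝ (iteratedFDeriv ℝ i f) x) := rfl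

theorem pD_smooth {f : P × E → V} (hf : ContDiff ℝ ∞ f) (i : ℕ) :
    ContDiff ℝ ∞ (fun z : P × E => iteratedFDeriv ℝ i (fun x => f (z.1, x)) z.2) := by
  induction i with
  | zero =>
    simp only [iteratedFDeriv_zero_eq_comp, Function.comp_def]
    exact (continuousMultilinearCurryFin0 ℝ E V).symm.contDiff.comp hf
  | succ i ih =>
    simp only [iter_succ]
    refine (cL E V i).contDiff.comp ?_
    refine ContDiff.fderiv (f := fun (z : P × E) x => iteratedFDeriv ℝ i (fun x => f (z.1, x)) x)
      (g := fun z => z.2) (m := ∞) ?_ contDiff_snd (by simp)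
    exact ih.comp ((contDiff_fst.comp contDiff_fst).prodMk contDiff_snd)

theorem swap_deriv {g h : ℝ × E → F} (hg : ContDiff ℝ ∞ g)
    (hd : ∀ t x, HasDerivAt (fun t => g (t, x)) (h (t, x)) t) (t : ℝ) (x : E) :
    HasDerivAt (fun t => fderiv ℝ (fun x => g (t, x)) x) (fderiv ℝ (fun x => h (t, x)) x) t := by
  have hdg : ∀ z, HasFDerivAt g (fderiv ℝ g z) z := fun z =>
    (hg.differentiable (by simp)).differentiableAt.hasFDerivAt
  have sdg : ContDiff ℝ ∞ (fderiv ℝ g) := hg.fderiv_right (by simp)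
  have hddg : ∀ z, HasFDerivAt (fderiv ℝ g) (fderiv ℝ (fderiv ℝ g) z) z := fun z =>
    (sdg.differentiable (by simp)).differentiableAt.hasFDerivAt
  have il : ∀ (t : ℝ) (x : E), HasDerivAt (fun t => (t, x)) ((1, 0) : ℝ × E) t := fun t x =>
    (hasDerivAt_id t).prodMk (hasDerivAt_const t x)
  have ir : ∀ (t : ℝ) (x : E), HasFDerivAt (fun x => (t, x)) (ContinuousLinearMap.inr ℝ ℝ E) x :=
    fun t x => hasFDerivAt_prodMk_right t x
  have eh : ∀ z, h z = fderiv ℝ g z (1, 0) := fun z =>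
    (hd z.1 z.2).unique ((hdg (z.1, z.2)).comp_hasDerivAt z.1 (il z.1 z.2))
  have e1 : ∀ t, fderiv ℝ (fun x => g (t, x)) x =
      (fderiv ℝ g (t, x)).comp (ContinuousLinearMap.inr ℝ ℝ E) := fun t =>
    ((hdg (t, x)).comp x (ir t x)).fderiv
  have e2 : fderiv ℝ (fun x => h (t, x)) x =
      (fderiv ℝ (fderiv ℝ g) (t, x) (1, 0)).comp (ContinuousLinearMap.inr ℝ ℝ E) := by
    simp only [eh]
    have h1 := ((hddg (t, x)).comp x (ir t x)).clm_apply (hasFDerivAt_const ((1, 0) : ℝ × E) x)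
    refine h1.fderiv.trans ?_
    ext v
    have sym := (hg.contDiffAt (x := (t, x))).isSymmSndFDerivAt
      (by simpa using WithTop.coe_le_coe.2 (le_top : (2 : ℕ∞) ≤ ⊤))
    simp [sym.eq (0, v) (1, 0)]
  rw [e2]
  simp only [e1]
  have h3 := (hddg (t, x)).comp_hasDerivAt t (il t x)
  exact h3.clm_comp (hasDerivAt_const t _) |>.congr_deriv (by simp)

theorem flat_deriv {f : ℝ × E → V} {lam : ℝ × E → ℝ} {M : ℕ} {G : ℝ × E → V}
    (hf : ContDiff ℝ ∞ f) (hl : ContDiff ℝ ∞ lam) (hG : ContDiff ℝ ∞ G)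
    (hd : ∀ t x, HasDerivAt (fun t => f (t, x)) (lam (t, x) ^ M • G (t, x)) t) (i : ℕ) (hi : i ≤ M) :
    ∃ Gi : ℝ × E → ContinuousMultilinearMap ℝ (fun _ : Fin i => E) V, ContDiff ℝ ∞ Gi ∧
      ∀ t x, HasDerivAt (fun t => iteratedFDeriv ℝ i (fun x => f (t, x)) x)
        (lam (t, x) ^ (M - i) • Gi (t, x)) t := by
  induction i with
  | zero =>
    refine ⟨fun z => (continuousMultilinearCurryFin0 ℝ E V).symm (G z),
      (continuousMultilinearCurryFin0 ℝ E V).symm.contDiff.comp hG, fun t x => ?_⟩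
    simp only [iteratedFDeriv_zero_eq_comp, Function.comp_def]
    have := ((continuousMultilinearCurryFin0 ℝ E V).symm.toContinuousLinearEquiv.toContinuousLinearMap.hasFDerivAt
      (x := f (t, x))).comp_hasDerivAt t (hd t x)
    refine this.congr_deriv ?_
    simp
  | succ i ih =>
    obtain ⟨Gi, sGi, hGi⟩ := ih (by omega)
    have sx : ∀ t : ℝ, ContDiff ℝ ∞ (fun x : E => (t, x)) := fun t =>
      contDiff_const.prodMk contDiff_id
    obtain ⟨k, hk⟩ : ∃ k, M - i = k + 1 := ⟨M - i - 1, by omega⟩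
    have hk' : M - (i + 1) = k := by omega
    have s1 : ContDiff ℝ ∞ (fun z : ℝ × E => fderiv ℝ (fun x => lam (z.1, x)) z.2) :=
      ContDiff.fderiv (f := fun (z : ℝ × E) x => lam (z.1, x)) (g := fun z => z.2) (m := ∞)
        (hl.comp ((contDiff_fst.comp contDiff_fst).prodMk contDiff_snd)) contDiff_snd (by simp)
    have s2 : ContDiff ℝ ∞ (fun z : ℝ × E => fderiv ℝ (fun x => Gi (z.1, x)) z.2) :=
      ContDiff.fderiv (f := fun (z : ℝ × E) x => Gi (z.1, x)) (g := fun z => z.2) (m := ∞)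
        (sGi.comp ((contDiff_fst.comp contDiff_fst).prodMk contDiff_snd)) contDiff_snd (by simp)
    refine ⟨fun z => cL E V i (lam z • fderiv ℝ (fun x => Gi (z.1, x)) z.2 +
      (((k + 1 : ℕ) : ℝ) • fderiv ℝ (fun x => lam (z.1, x)) z.2).smulRight (Gi z)), ?_, ?_⟩
    · exact (cL E V i).contDiff.comp ((hl.smul s2).add (((contDiff_const (c := ((k + 1 : ℕ) : ℝ))).smul s1).smulRight sGi))
    · intro t x
      have h1 := swap_deriv (g := fun z : ℝ × E => iteratedFDeriv ℝ i (fun x => f (z.1, x)) z.2)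
        (h := fun z => lam z ^ (M - i) • Gi z) (pD_smooth hf i) hGi t x
      have h2 : fderiv ℝ (fun x => lam (t, x) ^ (M - i) • Gi (t, x)) x =
          lam (t, x) ^ k • (lam (t, x) • fderiv ℝ (fun x => Gi (t, x)) x +
      (((k + 1 : ℕ) : ℝ) • fderiv ℝ (fun x => lam (t, x)) x).smulRight (Gi (t, x))) := by
        have d1 : HasFDerivAt (fun x => lam (t, x)) (fderiv ℝ (fun x => lam (t, x)) x) x :=
          (((hl.comp (sx t)).differentiable (by simp)).differentiableAt).hasFDerivAt
        have d2 : HasFDerivAt (fun x => Gi (t, x)) (fderiv ℝ (fun x => Gi (t, x)) x) x :=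
          (((sGi.comp (sx t)).differentiable (by simp)).differentiableAt).hasFDerivAt
        refine ((d1.pow (M - i)).smul d2).fderiv.trans ?_
        rw [hk]
        ext1 v
        simp only [add_apply, smul_apply, ContinuousLinearMap.smulRight_apply, smul_add, smul_smul,
          Nat.add_sub_cancel, nsmul_eq_mul, smul_eq_mul]
        rw [pow_succ]
        module
      rw [h2] at h1
      simp only [iter_succ, hk']
      have := ((cL E V i).toContinuousLinearEquiv.toContinuousLinearMap.hasFDerivAt
        (x := fderiv ℝ (iteratedFDeriv ℝ i fun x => f (t, x)) x)).comp_hasDerivAt t h1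
      refine this.congr_deriv ?_
      simp

theorem flat_zero {f : ℝ × E → V} {lam : ℝ × E → ℝ} {M : ℕ} {G : ℝ × E → V}
    (hf : ContDiff ℝ ∞ f) (hl : ContDiff ℝ ∞ lam) (hG : ContDiff ℝ ∞ G)
    (hd : ∀ t x, HasDerivAt (fun t => f (t, x)) (lam (t, x) ^ M • G (t, x)) t) (i : ℕ) (hi : i < M)
    (t : ℝ) (x : E) (h0 : lam (t, x) = 0) :
    HasDerivAt (fun t => iteratedFDeriv ℝ i (fun x => f (t, x)) x) 0 t := by
  obtain ⟨Gi, _, h⟩ := flat_deriv hf hl hG hd i hi.le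
  have := h t x
  rwa [h0, zero_pow (by omega), zero_smul] at this

theorem flat_subst {f : ℝ × E → V} {lam : ℝ × E → ℝ} {M : ℕ} {G : ℝ × E → V}
    (hf : ContDiff ℝ ∞ f) (hl : ContDiff ℝ ∞ lam) (hG : ContDiff ℝ ∞ G)
    (hd : ∀ t x, HasDerivAt (fun t => f (t, x)) (lam (t, x) ^ M • G (t, x)) t)
    {c : E → ℝ} (hc : ContDiff ℝ ∞ c) (i : ℕ) (hi : i ≤ M) :
    ∃ K : E → ContinuousMultilinearMap ℝ (fun _ : Fin i => E) V, ContDiff ℝ ∞ K ∧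
      ∀ x, iteratedFDeriv ℝ i (fun x => f (c x, x)) x =
        iteratedFDeriv ℝ i (fun x' => f (c x, x')) x + lam (c x, x) ^ (M - i + 1) • K x := by
  have hcx : ContDiff ℝ ∞ (fun x : E => (c x, x)) := hc.prodMk contDiff_id
  induction i with
  | zero =>
    refine ⟨fun _ => 0, contDiff_const, fun x => ?_⟩
    simp [iteratedFDeriv_zero_eq_comp]
  | succ i ih =>
    obtain ⟨K, sK, hK⟩ := ih (by omega)
    obtain ⟨Gi, sGi, hGi⟩ := flat_deriv hf hl hG hd i (by omega)
    set k := M - i with hk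
    have hk' : M - (i + 1) + 1 = k := by omega
    set μ : E → ℝ := fun x => lam (c x, x) with hμ
    have sμ : ContDiff ℝ ∞ μ := hl.comp hcx
    set g : ℝ × E → ContinuousMultilinearMap ℝ (fun _ : Fin i => E) V :=
      fun z => iteratedFDeriv ℝ i (fun x => f (z.1, x)) z.2 with hg
    have sg : ContDiff ℝ ∞ g := pD_smooth hf i
    refine ⟨fun x => cL E V i ((fderiv ℝ c x).smulRight (Gi (c x, x)) +
      (μ x • fderiv ℝ K x + (((k + 1 : ℕ) : ℝ) • fderiv ℝ μ x).smulRight (K x))), ?_, ?_⟩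
    · refine (cL E V i).contDiff.comp ?_
      have a1 : ContDiff ℝ ∞ (fderiv ℝ c) := hc.fderiv_right (by simp)
      have a2 : ContDiff ℝ ∞ (fderiv ℝ K) := sK.fderiv_right (by simp)
      have a3 : ContDiff ℝ ∞ (fderiv ℝ μ) := sμ.fderiv_right (by simp)
      exact (a1.smulRight (sGi.comp hcx)).add ((sμ.smul a2).add (((contDiff_const (c := ((k + 1 : ℕ) : ℝ))).smul a3).smulRight sK))
    · intro x
      have e : iteratedFDeriv ℝ i (fun x => f (c x, x)) = fun x =>
        iteratedFDeriv ℝ i (fun x' => f (c x, x')) x + μ x ^ (k + 1) • K x := funext hK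
      rw [iter_succ, iter_succ, e, hk']
      have d1 : HasFDerivAt μ (fderiv ℝ μ x) x :=
        (sμ.differentiable (by simp)).differentiableAt.hasFDerivAt
      have d2 : HasFDerivAt K (fderiv ℝ K x) x :=
        (sK.differentiable (by simp)).differentiableAt.hasFDerivAt
      have dc : HasFDerivAt c (fderiv ℝ c x) x :=
        (hc.differentiable (by simp)).differentiableAt.hasFDerivAt
      have dg : HasFDerivAt g (fderiv ℝ g (c x, x)) (c x, x) :=
        ((sg.differentiable (by simp)).differentiableAt (x := (c x, x))).hasFDerivAt
      set D := fderiv ℝ g (c x, x) with hD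
      have h1 : D (1, 0) = μ x ^ k • Gi (c x, x) :=
        (HasFDerivAt.comp_hasDerivAt (l := g) (f := fun t => (t, x)) (c x) dg
          ((hasDerivAt_id (c x)).prodMk (hasDerivAt_const (c x) x))).unique (hGi (c x) x)
      have h2 : fderiv ℝ (iteratedFDeriv ℝ i fun x' => f (c x, x')) x =
          D.comp (ContinuousLinearMap.inr ℝ ℝ E) :=
        (dg.comp x (hasFDerivAt_prodMk_right (c x) x)).fderiv
      have h3 : HasFDerivAt (fun x => iteratedFDeriv ℝ i (fun x' => f (c x, x')) x)
          (D.comp ((fderiv ℝ c x).prod (ContinuousLinearMap.id ℝ E))) x :=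
        HasFDerivAt.comp (g := g) (f := fun x => (c x, x)) x dg (dc.prodMk (hasFDerivAt_id x))
      refine (congrArg _ (h3.add ((d1.pow (k + 1)).smul d2)).fderiv).trans ?_
      rw [h2, ← map_smul, ← map_add]
      congr 1
      ext1 v
      have h4 : D (fderiv ℝ c x v, v) = fderiv ℝ c x v • D (1, 0) + D (0, v) := by
        rw [← map_smul, ← map_add]; simp
      simp only [add_apply, ContinuousLinearMap.comp_apply,
        ContinuousLinearMap.prod_apply, ContinuousLinearMap.inr_apply,
        ContinuousLinearMap.id_apply, h4, h1, smul_apply,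
        ContinuousLinearMap.smulRight_apply, smul_add, smul_smul]
      simp only [Nat.add_sub_cancel, nsmul_eq_mul, smul_eq_mul]
      rw [mul_comm (fderiv ℝ c x v), pow_succ]
      module

theorem flat_subst_eq {f : ℝ × E → V} {lam : ℝ × E → ℝ} {M : ℕ} {G : ℝ × E → V}
    (hf : ContDiff ℝ ∞ f) (hl : ContDiff ℝ ∞ lam) (hG : ContDiff ℝ ∞ G)
    (hd : ∀ t x, HasDerivAt (fun t => f (t, x)) (lam (t, x) ^ M • G (t, x)) t)
    {c : E → ℝ} (hc : ContDiff ℝ ∞ c) (i : ℕ) (hi : i ≤ M) (x : E) (h0 : lam (c x, x) = 0) :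
    iteratedFDeriv ℝ i (fun x => f (c x, x)) x =
        iteratedFDeriv ℝ i (fun x' => f (c x, x')) x := by
  obtain ⟨K, _, h⟩ := flat_subst hf hl hG hd hc i hi
  rw [h x, h0]; simp

end calc1

def Pol (M : ℕ) (T : ℕ → ℝ → ℝ) (Q : ℝ → ℝ) (t y : ℝ) : ℝ :=
  ∑ m ∈ Finset.range (M + 1), T m t / (m.factorial : ℝ) * (y - Q t) ^ m

theorem JetT.mono {M : ℕ} {Q : ℝ → ℝ} {T : ℕ → ℝ → ℝ} (h : JetT (M + 1) Q T) : JetT M Q T :=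
  ⟨fun m hm => h.smooth m (by omega), fun m hm => h.der m (by omega),
    fun m h1 hm => h.per m h1 (by omega)⟩

theorem Pol_deriv {M : ℕ} {Q : ℝ → ℝ} {T : ℕ → ℝ → ℝ} (h : JetT M Q T) (hQ : ContDiff ℝ ∞ Q)
    (t y : ℝ) : HasDerivAt (fun t => Pol M T Q t y)
      ((y - Q t) ^ M * (T (M + 1) t * deriv Q t / (M.factorial : ℝ))) t := by
  have dQ : HasDerivAt Q (deriv Q t) t := (hQ.differentiable (by simp)).differentiableAt.hasDerivAt
  induction M with
  | zero =>
    simp only [Pol]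
    simpa [mul_comm] using h.der 0 le_rfl t
  | succ M ih =>
    have h1 := ih h.mono
    have e : (fun t => Pol (M + 1) T Q t y) = fun t => Pol M T Q t y +
        T (M + 1) t / ((M + 1).factorial : ℝ) * (y - Q t) ^ (M + 1) := by
      funext t; simp only [Pol]; rw [Finset.sum_range_succ _ (M + 1)]
    rw [e]
    have h2 := ((h.der (M + 1) le_rfl t).div_const ((M + 1).factorial : ℝ)).mul
      ((dQ.const_sub y).pow (M + 1))
    refine (h1.add h2).congr_deriv ?_
    simp only [Pi.pow_apply, Nat.add_sub_cancel, Nat.factorial_succ]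
    have : (M.factorial : ℝ) ≠ 0 := by positivity
    have : ((M : ℝ) + 1) ≠ 0 := by positivity
    push_cast
    field_simp
    ring

theorem Pol_smooth {M : ℕ} {Q : ℝ → ℝ} {T : ℕ → ℝ → ℝ} (h : JetT M Q T) (hQ : ContDiff ℝ ∞ Q) :
    ContDiff ℝ ∞ (fun z : ℝ × ℝ => Pol M T Q z.1 z.2) := by
  unfold Pol
  refine ContDiff.sum fun m hm => ?_
  rw [Finset.mem_range] at hm
  exact (((h.smooth m (by omega)).comp contDiff_fst).div_const _).mul
    ((contDiff_snd.sub (hQ.comp contDiff_fst)).pow m)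

theorem shift_int {T : ℝ → ℝ} (h : ∀ t, T (t + 1) = T t + 1) (L : ℤ) (t : ℝ) :
    T (t + L) = T t + L := by
  have hp : Function.Periodic (fun t => T t - t) 1 := fun t => by simp only [h]; ring
  have := hp.int_mul L t
  simp only [mul_one] at this
  linarith

theorem per_int {T : ℝ → ℝ} (h : ∀ t, T (t + 1) = T t) (L : ℤ) (t : ℝ) :
    T (t + L) = T t := by
  have hp : Function.Periodic T 1 := h
  have := hp.int_mul L t
  simpa only [mul_one] using this

theorem Pol_shift {M : ℕ} {Q : ℝ → ℝ} {T : ℕ → ℝ → ℝ} (h : JetT M Q T) (t y t' y' a : ℝ) (L : ℤ)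
    (ht : t' = t + L) (hy : y' - Q t' = y - Q t) (hT : T 0 t' = T 0 t + a) :
    Pol M T Q t' y' = Pol M T Q t y + a := by
  simp only [Pol]
  rw [Finset.sum_range_succ' _ M, Finset.sum_range_succ' _ M, hy, hT]
  have : ∀ m ∈ Finset.range M, T (m + 1) t' / ((m + 1).factorial : ℝ) * (y - Q t) ^ (m + 1) =
      T (m + 1) t / ((m + 1).factorial : ℝ) * (y - Q t) ^ (m + 1) := by
    intro m hm
    rw [Finset.mem_range] at hm
    rw [ht, per_int (h.per (m + 1) (by omega) (by omega))]
  rw [Finset.sum_congr rfl this]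
  simp; ring

def spol {M : ℕ} (c : Fin (M + 1) → ℝ) (z : ℝ) : ℝ := ∑ m, c m * z ^ (m : ℕ)

theorem Pol_spol (M : ℕ) (T : ℕ → ℝ → ℝ) (Q : ℝ → ℝ) (t y : ℝ) :
    Pol M T Q t y = spol (fun m : Fin (M + 1) => T m t / ((m : ℕ).factorial : ℝ)) (y - Q t) := by
  simp only [Pol, spol, Finset.sum_range]

theorem Pol_spol' (M : ℕ) (T : ℕ → ℝ → ℝ) (Q : ℝ → ℝ) (t y : ℝ) :
    Pol M T Q t y = T 0 t + spol (fun m : Fin (M + 1) => if (m : ℕ) = 0 then 0 else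
      T m t / ((m : ℕ).factorial : ℝ)) (y - Q t) := by
  simp only [Pol, spol]
  rw [Finset.sum_range, Fin.sum_univ_succ, Fin.sum_univ_succ]
  simp

theorem coef_small {x η : ℝ} (m : ℕ) (h : |x| ≤ η) : |x / (m.factorial : ℝ)| ≤ η := by
  rw [abs_div]
  have : (1:ℝ) ≤ |(m.factorial : ℝ)| := by
    rw [abs_of_nonneg (by positivity)]; exact_mod_cast Nat.one_le_iff_ne_zero.2 m.factorial_ne_zero
  exact (div_le_self (abs_nonneg _) this).trans h

section calc2
variable {E V : Type*} [NormedAddCommGroup E] [NormedSpace ℝ E]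
  [NormedAddCommGroup V] [NormedSpace ℝ V]

theorem flat_comp {M : ℕ} {Q : ℝ → ℝ} {T S : ℕ → ℝ → ℝ} (hT : JetT M Q T) (hS : JetT M Q S)
    (hQ : ContDiff ℝ ∞ Q) {A : E × ℝ × ℝ → V} (hA : ContDiff ℝ ∞ A) {q : E → ℝ}
    (hq : ContDiff ℝ ∞ q) :
    ContDiff ℝ ∞ (fun z : ℝ × E => A (z.2, Pol M T Q z.1 (q z.2), Pol M S Q z.1 (q z.2))) ∧
    ContDiff ℝ ∞ (fun z : ℝ × E => q z.2 - Q z.1) ∧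
    ∃ G : ℝ × E → V, ContDiff ℝ ∞ G ∧
      ∀ t x, HasDerivAt (fun t => A (x, Pol M T Q t (q x), Pol M S Q t (q x)))
        ((q x - Q t) ^ M • G (t, x)) t := by
  have s0 : ContDiff ℝ ∞ (fun z : ℝ × E => (z.1, q z.2)) :=
    contDiff_fst.prodMk (hq.comp contDiff_snd)
  have sT : ContDiff ℝ ∞ (fun z : ℝ × E => Pol M T Q z.1 (q z.2)) := (Pol_smooth hT hQ).comp s0
  have sS : ContDiff ℝ ∞ (fun z : ℝ × E => Pol M S Q z.1 (q z.2)) := (Pol_smooth hS hQ).comp s0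
  have si : ContDiff ℝ ∞ (fun z : ℝ × E => (z.2, Pol M T Q z.1 (q z.2), Pol M S Q z.1 (q z.2))) :=
    contDiff_snd.prodMk (sT.prodMk sS)
  have sQ' : ContDiff ℝ ∞ (deriv Q) := (contDiff_infty_iff_deriv.1 hQ).2
  refine ⟨hA.comp si, (hq.comp contDiff_snd).sub (hQ.comp contDiff_fst),
    fun z => fderiv ℝ A (z.2, Pol M T Q z.1 (q z.2), Pol M S Q z.1 (q z.2))
      (0, T (M + 1) z.1 * deriv Q z.1 / (M.factorial : ℝ),
        S (M + 1) z.1 * deriv Q z.1 / (M.factorial : ℝ)), ?_, ?_⟩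
  · have a : ContDiff ℝ ∞ (fderiv ℝ A) := hA.fderiv_right (by simp)
    refine (a.comp si).clm_apply (contDiff_const.prodMk (ContDiff.prodMk ?_ ?_))
    · exact (((hT.smooth (M + 1) le_rfl).comp contDiff_fst).mul (sQ'.comp contDiff_fst)).div_const _
    · exact (((hS.smooth (M + 1) le_rfl).comp contDiff_fst).mul (sQ'.comp contDiff_fst)).div_const _
  · intro t x
    have dA : HasFDerivAt A (fderiv ℝ A (x, Pol M T Q t (q x), Pol M S Q t (q x)))
        (x, Pol M T Q t (q x), Pol M S Q t (q x)) :=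
      (hA.differentiable (by simp)).differentiableAt.hasFDerivAt
    have := HasFDerivAt.comp_hasDerivAt (l := A)
      (f := fun t => (x, Pol M T Q t (q x), Pol M S Q t (q x))) t dA
      ((hasDerivAt_const t x).prodMk ((Pol_deriv hT hQ t (q x)).prodMk (Pol_deriv hS hQ t (q x))))
    refine this.congr_deriv ?_
    rw [← map_smul]
    simp

theorem tube {Z W F : Type*} [TopologicalSpace Z] [PseudoMetricSpace W] [PseudoMetricSpace F]
    {K S : Set Z} (hK : IsCompact K) {f : Z × W → F} (hf : Continuous f) (w0 : W)
    (hred : ∀ z ∈ S, ∃ z' ∈ K, ∀ w, f (z', w) = f (z, w)) (ε : ℝ) (hε : 0 < ε) :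
    ∃ δ > 0, ∀ z ∈ S, ∀ w, dist w w0 ≤ δ → dist (f (z, w)) (f (z, w0)) < ε := by
  have hO : IsOpen {p : Z × W | dist (f p) (f (p.1, w0)) < ε} :=
    isOpen_lt (hf.dist (hf.comp (by fun_prop))) continuous_const
  obtain ⟨u, v, _, hv, hKu, hwv, huv⟩ := generalized_tube_lemma hK (isCompact_singleton (x := w0)) hO
    (by
      rintro ⟨z, w⟩ ⟨_, hw⟩
      have hw' : w = w0 := hw
      subst hw'
      simpa using hε)
  obtain ⟨δ, hδ, hb⟩ := Metric.isOpen_iff.1 hv w0 (hwv rfl)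
  refine ⟨δ / 2, by positivity, fun z hz w hw => ?_⟩
  obtain ⟨z', hz', he⟩ := hred z hz
  rw [← he w, ← he w0]
  exact huv (show (z', w) ∈ u ×ˢ v from ⟨hKu hz', hb (by rw [Metric.mem_ball]; linarith)⟩)

theorem update_smooth {n : ℕ} (j : Fin n) :
    ContDiff ℝ ∞ (fun z : (Fin n → ℝ) × ℝ => Function.update z.1 j z.2) := by
  rw [contDiff_pi]
  intro i
  by_cases h : i = j
  · subst h; simp only [Function.update_self]; exact contDiff_snd
  · simp only [Function.update_of_ne h]; exact (contDiff_apply ℝ ℝ i).comp contDiff_fst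

theorem common_delta {Pr : ℕ → ℝ → Prop} (r : ℕ) (hm : ∀ i δ δ', δ' ≤ δ → Pr i δ → Pr i δ')
    (h : ∀ i ≤ r, ∃ δ > 0, Pr i δ) : ∃ δ > 0, ∀ i ≤ r, Pr i δ := by
  induction r with
  | zero =>
    obtain ⟨δ, h0, h1⟩ := h 0 le_rfl
    exact ⟨δ, h0, fun i hi => by obtain rfl : i = 0 := by omega
                                 exact h1⟩
  | succ r ih =>
    obtain ⟨δ, h0, h1⟩ := ih fun i hi => h i (by omega)
    obtain ⟨δ', h0', h1'⟩ := h (r + 1) le_rfl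
    refine ⟨min δ δ', lt_min h0 h0', fun i hi => ?_⟩
    rcases Nat.lt_or_ge r i with h2 | h2
    · obtain rfl : i = r + 1 := by omega
      exact hm _ _ _ (min_le_right _ _) h1'
    · exact hm _ _ _ (min_le_left _ _) (h1 i h2)
end calc2

theorem iter_shift {E V : Type*} [NormedAddCommGroup E] [NormedSpace ℝ E]
    [NormedAddCommGroup V] [NormedSpace ℝ V] {f g : E → V} {a : E} (h : ∀ x, f (x + a) = g x)
    (i : ℕ) (x : E) : iteratedFDeriv ℝ i f (x + a) = iteratedFDeriv ℝ i g x := by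
  have : g = fun x => f (x + a) := funext fun x => (h x).symm
  rw [this, iteratedFDeriv_comp_add_right]

def flv {n : ℕ} (x : Vec n) : Fin n → ℤ := fun j => -⌊x j⌋

theorem flv_norm {n : ℕ} (x : Vec n) : ‖x + zcast (flv x)‖ ≤ 1 := by
  rw [pi_norm_le_iff_of_nonneg zero_le_one]
  intro i
  simp only [Pi.add_apply, zcast, flv, Int.cast_neg, Real.norm_eq_abs]
  rw [abs_le]
  constructor <;> linarith [Int.floor_le (x i), Int.lt_floor_add_one (x i)]

theorem flv_norm_apply {n : ℕ} (x : Vec n) (j : Fin n) : |x j + (flv x j : ℝ)| ≤ 1 := by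
  have h1 := norm_le_pi_norm (x + zcast (flv x)) j
  exact h1.trans (flv_norm x)

theorem UC {n : ℕ} {F : Type*} [NormedAddCommGroup F] {f : Vec n × Vec n → F} (hf : Continuous f)
    (hp : ∀ m x τ, f (x + zcast m, τ + zcast m) = f (x, τ)) (R ε : ℝ) (hε : 0 < ε) :
    ∃ δ > 0, ∀ x τ τ', ‖x - τ‖ ≤ R → ‖τ' - τ‖ ≤ δ → ‖f (x, τ') - f (x, τ)‖ < ε := by
  obtain ⟨δ, h0, h⟩ := tube (Z := Vec n × Vec n) (W := Vec n)
    (K := Metric.closedBall 0 1 ×ˢ Metric.closedBall 0 (R + 1)) (S := {z | ‖z.1 - z.2‖ ≤ R})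
    ((isCompact_closedBall _ _).prod (isCompact_closedBall _ _))
    (f := fun z => f (z.1.1, z.1.2 + z.2)) (hf.comp (by fun_prop)) 0
    (by
      rintro ⟨x, τ⟩ hz
      refine ⟨(x + zcast (flv x), τ + zcast (flv x)), ?_, ?_⟩
      · have h1 := flv_norm x
        have hz' : ‖x - τ‖ ≤ R := hz
        simp only [Set.mem_prod, mem_closedBall_zero_iff]
        refine ⟨h1, ?_⟩
        have : τ + zcast (flv x) = (x + zcast (flv x)) - (x - τ) := by abel
        rw [this]
        exact (norm_sub_le _ _).trans (by linarith)
      · intro w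
        simp only
        rw [add_right_comm, hp]) ε hε
  refine ⟨δ, h0, fun x τ τ' hx hd => ?_⟩
  have := h (x, τ) hx (τ' - τ) (by rwa [dist_zero_right])
  simpa [dist_eq_norm] using this

theorem UC1 {n : ℕ} {F : Type*} [NormedAddCommGroup F] {f : Vec n → F} (hf : Continuous f)
    (hp : ∀ m x, f (x + zcast m) = f x) (ε : ℝ) (hε : 0 < ε) :
    ∃ δ > 0, ∀ x x', ‖x' - x‖ ≤ δ → ‖f x' - f x‖ < ε := by
  obtain ⟨δ, h0, h⟩ := UC (f := fun z : Vec n × Vec n => f z.2) (hf.comp continuous_snd)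
    (fun m x τ => hp m τ) 0 ε hε
  exact ⟨δ, h0, fun x x' hd => h x x x' (by simp) hd⟩

theorem spol_smooth {M : ℕ} :
    ContDiff ℝ ∞ (fun z : (Fin (M + 1) → ℝ) × ℝ => spol z.1 z.2) := by
  unfold spol
  exact ContDiff.sum fun m _ => ((contDiff_apply ℝ ℝ m).comp contDiff_fst).mul (contDiff_snd.pow _)

theorem spol_zero {M : ℕ} (z : ℝ) : spol (0 : Fin (M + 1) → ℝ) z = 0 := by simp [spol]

theorem update_zcast {n : ℕ} (τ : Vec n) (j : Fin n) (b : ℝ) (m : Fin n → ℤ) :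
    Function.update (τ + zcast m) j (b + m j) = Function.update τ j b + zcast m := by
  funext i
  by_cases h : i = j
  · subst h; simp [zcast]
  · simp [h]

theorem soft {k : ℕ} {V : Type*} [NormedAddCommGroup V] [NormedSpace ℝ V] (r M : ℕ)
    {H : Vec (k + 1) × Vec (k + 1) → V} (hH : ContDiff ℝ ∞ H)
    (hp : ∀ m x τ, H (x + zcast m, τ + zcast m) = H (x, τ))
    {w : Vec (k + 1) → ℝ} (hw : ContDiff ℝ ∞ w) (hwp : ∀ m x, w (x + zcast m) = w x)
    (j : Fin (k + 1)) (e : V) (R ε : ℝ) (hε : 0 < ε) :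
    ∃ η > 0, ∀ i ≤ r, ∀ (x τ : Vec (k + 1)) (b y : ℝ) (c s : Fin (M + 1) → ℝ),
      ‖x - τ‖ ≤ R → |b - x j| ≤ R → |y - x (Fin.last k)| ≤ R → (∀ m, |c m| ≤ η) →
      (∀ m, |s m| ≤ η) →
      ‖iteratedFDeriv ℝ i (fun x => H (x, Function.update τ j
          (b + spol c (x (Fin.last k) - w x - y))) + spol s (x (Fin.last k) - w x - y) • e) x -
        iteratedFDeriv ℝ i (fun x => H (x, Function.update τ j b)) x‖ < ε := by
  refine common_delta (Pr := fun i η => ∀ (x τ : Vec (k + 1)) (b y : ℝ) (c s : Fin (M + 1) → ℝ),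
      ‖x - τ‖ ≤ R → |b - x j| ≤ R → |y - x (Fin.last k)| ≤ R → (∀ m, |c m| ≤ η) →
      (∀ m, |s m| ≤ η) →
      ‖iteratedFDeriv ℝ i (fun x => H (x, Function.update τ j
          (b + spol c (x (Fin.last k) - w x - y))) + spol s (x (Fin.last k) - w x - y) • e) x -
        iteratedFDeriv ℝ i (fun x => H (x, Function.update τ j b)) x‖ < ε) r ?_ ?_
  · intro i δ δ' hd h x τ b y c s h1 h2 h3 h4 h5
    exact h x τ b y c s h1 h2 h3 (fun m => (h4 m).trans hd) (fun m => (h5 m).trans hd)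
  intro i hi
  let C := Fin (M + 1) → ℝ
  let F : (Vec (k + 1) × ℝ × ℝ × C × C) × Vec (k + 1) → V := fun z =>
    H (z.2, Function.update z.1.1 j
          (z.1.2.1 + spol z.1.2.2.2.1 (z.2 (Fin.last k) - w z.2 - z.1.2.2.1))) +
      spol z.1.2.2.2.2 (z.2 (Fin.last k) - w z.2 - z.1.2.2.1) • e
  have hl : ContDiff ℝ ∞ (fun z : (Vec (k + 1) × ℝ × ℝ × C × C) × Vec (k + 1) =>
      z.2 (Fin.last k) - w z.2 - z.1.2.2.1) := by
    refine ContDiff.sub (ContDiff.sub ?_ (hw.comp contDiff_snd)) (by fun_prop)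
    exact (contDiff_apply ℝ ℝ (Fin.last k)).comp contDiff_snd
  have hF : ContDiff ℝ ∞ F := by
    refine ContDiff.add ?_ ?_
    · refine hH.comp (contDiff_snd.prodMk ((update_smooth j).comp
        (ContDiff.prodMk (by fun_prop) (ContDiff.add (by fun_prop) ?_))))
      exact spol_smooth.comp (ContDiff.prodMk (by fun_prop) hl)
    · exact (spol_smooth.comp (ContDiff.prodMk (by fun_prop) hl)).smul contDiff_const
  have hg := (pD_smooth hF i).continuous
  obtain ⟨δ, h0, h⟩ := tube (Z := Vec (k + 1) × Vec (k + 1) × ℝ × ℝ) (W := C × C)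
    (K := Metric.closedBall 0 1 ×ˢ Metric.closedBall 0 (R + 1) ×ˢ Metric.closedBall 0 (R + 1) ×ˢ
      Metric.closedBall 0 (R + 1))
    (S := {z | ‖z.1 - z.2.1‖ ≤ R ∧ |z.2.2.1 - z.1 j| ≤ R ∧ |z.2.2.2 - z.1 (Fin.last k)| ≤ R})
    ((isCompact_closedBall _ _).prod ((isCompact_closedBall _ _).prod
      ((isCompact_closedBall _ _).prod (isCompact_closedBall _ _))))
    (f := fun z => iteratedFDeriv ℝ i (fun x => F ((z.1.2.1, z.1.2.2.1, z.1.2.2.2, z.2.1, z.2.2), x))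
      z.1.1)
    (hg.comp (g := fun z : (Vec (k + 1) × ℝ × ℝ × C × C) × Vec (k + 1) =>
      iteratedFDeriv ℝ i (fun x => F (z.1, x)) z.2)
      (f := fun z : (Vec (k + 1) × Vec (k + 1) × ℝ × ℝ) × C × C =>
      ((z.1.2.1, z.1.2.2.1, z.1.2.2.2, z.2.1, z.2.2), z.1.1)) (by fun_prop)) 0
    (by
      rintro ⟨x, τ, b, y⟩ ⟨h1, h2, h3⟩
      dsimp only at h1 h2 h3
      refine ⟨(x + zcast (flv x), τ + zcast (flv x), b + flv x j, y + flv x (Fin.last k)), ?_, ?_⟩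
      · have f1 := flv_norm x
        have f2 := flv_norm_apply x j
        have f3 := flv_norm_apply x (Fin.last k)
        simp only [Set.mem_prod, mem_closedBall_zero_iff, Real.norm_eq_abs]
        rw [abs_le] at *
        refine ⟨f1, ?_, ?_, ?_⟩
        · have : τ + zcast (flv x) = (x + zcast (flv x)) - (x - τ) := by abel
          rw [this]
          exact (norm_sub_le _ _).trans (by linarith)
        · constructor <;> linarith
        · rw [abs_le]; constructor <;> linarith
      · rintro ⟨c, s⟩
        refine iter_shift (fun x' => ?_) i x
        simp only [F]
        have e1 : (x' + zcast (flv x)) (Fin.last k) - w (x' + zcast (flv x)) -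
            (y + (flv x (Fin.last k) : ℝ)) = x' (Fin.last k) - w x' - y := by
          rw [hwp]; simp [zcast]; ring
        rw [e1, add_right_comm, update_zcast, hp]) ε hε
  refine ⟨δ, h0, fun x τ b y c s h1 h2 h3 h4 h5 => ?_⟩
  have := h (x, τ, b, y) ⟨h1, h2, h3⟩ (c, s) (by
    rw [dist_zero_right, Prod.norm_def, max_le_iff, pi_norm_le_iff_of_nonneg h0.le,
      pi_norm_le_iff_of_nonneg h0.le]
    exact ⟨h4, h5⟩)
  simpa [dist_eq_norm, F, spol_zero] using this

theorem soft_le {k : ℕ} (x τ : Vec (k + 1)) (j : Fin (k + 1)) : |x j - τ j| ≤ ‖x - τ‖ :=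
  norm_le_pi_norm (x - τ) j

def Stage (k ℓ r j : ℕ) (σ : (i : ℕ) → Vec (k + 1) → SymMap (k + 1) ℓ i) : Prop :=
  ∀ ε > 0, ∃ (w : Vec (k + 1) → ℝ) (δ : ℝ) (H : Vec (k + 1) × Vec (k + 1) → Vec ℓ),
    ContDiff ℝ ∞ w ∧ ContDiff ℝ ∞ H ∧ 0 < δ ∧ (∀ m x, w (x + zcast m) = w x) ∧
    (∀ x a, w (Function.update x (Fin.last k) a) = w x) ∧ (∀ x, |w x| ≤ ε) ∧
    (∀ m x τ, H (x + zcast m, τ + zcast m) = H (x, τ)) ∧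
    (∀ x τ τ', (∀ i : Fin (k + 1), j ≤ i.val → τ i = τ' i) → H (x, τ) = H (x, τ')) ∧
    (∀ i ≤ r, ∀ x τ, (∀ l, l ≠ Fin.last k → |x l - τ l| ≤ δ) →
      |x (Fin.last k) - w x - τ (Fin.last k)| ≤ δ →
      ‖iteratedFDeriv ℝ i (fun x => H (x, τ)) x - σ i x‖ < ε)

set_option maxHeartbeats 2000000 in
theorem stage_step {k ℓ r j : ℕ} (hj : j < k) {σ : (i : ℕ) → Vec (k + 1) → SymMap (k + 1) ℓ i}
    (hs : Stage k ℓ r j σ) : Stage k ℓ r (j + 1) σ := by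
  intro ε hε
  obtain ⟨w, δ, H, sw, sH, hδ, wper, wlast, wb, Hper, Hind, Hap⟩ := hs (ε / 3) (by positivity)
  set L := Fin.last k with hL
  set jj : Fin (k + 1) := ⟨j, by omega⟩ with hjj
  have hne : jj ≠ L := by
    intro h; have := congrArg Fin.val h; simp [hjj, hL] at this; omega
  set M := r + 1 with hM
  obtain ⟨η, hη, hsoft⟩ := soft r M sH Hper sw wper jj (0 : Vec ℓ) (δ + ε + 1) (ε / 3) (by positivity)
  obtain ⟨Q, T, sQ, hT, Qper, Tper, Qb, Tb, Tmb⟩ := wig M (min δ (ε / 3)) (min η δ)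
    (by positivity) (by positivity)
  have sjj : ContDiff ℝ ∞ (fun x : Vec (k + 1) => x jj) := contDiff_apply ℝ ℝ jj
  have sL : ContDiff ℝ ∞ (fun x : Vec (k + 1) => x L) := contDiff_apply ℝ ℝ L
  set w' : Vec (k + 1) → ℝ := fun x => w x + Q (x jj) with hw'
  set H' : Vec (k + 1) × Vec (k + 1) → Vec ℓ := fun z => H (z.1, Function.update z.2 jj
    (Pol M T Q (z.1 jj) (z.1 L - w z.1 - z.2 L))) with hH'
  have sw' : ContDiff ℝ ∞ w' := sw.add (sQ.comp sjj)
  have sH' : ContDiff ℝ ∞ H' := by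
    refine sH.comp (contDiff_fst.prodMk ((update_smooth jj).comp (contDiff_snd.prodMk ?_)))
    exact (Pol_smooth hT sQ).comp ((sjj.comp contDiff_fst).prodMk
      (((sL.comp contDiff_fst).sub (sw.comp contDiff_fst)).sub (sL.comp contDiff_snd)))
  have w'per : ∀ m x, w' (x + zcast m) = w' x := by
    intro m x
    simp only [hw', wper]
    congr 1
    exact per_int Qper (m jj) (x jj)
  have Hper' : ∀ m x τ, H' (x + zcast m, τ + zcast m) = H' (x, τ) := by
    intro m x τ
    simp only [hH']
    have e1 : (x + zcast m) jj = x jj + (m jj : ℝ) := rfl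
    have e2 : (x + zcast m) L - w (x + zcast m) - (τ + zcast m) L = x L - w x - τ L := by
      rw [wper]; simp; ring
    rw [e2, e1, Pol_shift hT (x jj) (x L - w x - τ L) (x jj + (m jj : ℝ)) (x L - w x - τ L) (m jj)
      (m jj) rfl (by rw [per_int Qper]) (shift_int Tper _ _), update_zcast, Hper]
  have w'b : ∀ x, |w' x| ≤ 2 * ε / 3 := fun x => by
    have h1 := wb x
    have h2 := (Qb (x jj)).trans (min_le_right _ _)
    simp only [hw']
    exact (abs_add_le _ _).trans (by linarith)
  -- exact estimate
  have exact_est : ∀ i ≤ r, ∀ x τ, (∀ l, l ≠ L → |x l - τ l| ≤ δ) → x L - w' x = τ L →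
      ‖iteratedFDeriv ℝ i (fun x => H' (x, τ)) x - σ i x‖ < 2 * ε / 3 := by
    intro i hi x τ hx hxL
    have hq : ContDiff ℝ ∞ (fun x : Vec (k + 1) => x L - w x - τ L) :=
      (sL.sub sw).sub contDiff_const
    obtain ⟨s1, s2, G, sG, hG⟩ := flat_comp hT hT sQ
      (A := fun z : Vec (k + 1) × ℝ × ℝ => H (z.1, Function.update τ jj z.2.1))
      (sH.comp (contDiff_fst.prodMk ((update_smooth jj).comp
        (contDiff_const.prodMk (contDiff_fst.comp contDiff_snd))))) hq
    have key := flat_subst_eq s1 s2 sG hG sjj i (by omega) x (by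
      simp only [hw'] at hxL ⊢; linarith)
    have e0 : (fun x => H' (x, τ)) = fun x => H (x, Function.update τ jj
      (Pol M T Q (x jj) (x L - w x - τ L))) := rfl
    rw [e0]
    refine (congrArg (fun z => ‖z - σ i x‖) key).trans_lt ?_
    have e1 : (fun x' => H (x', Function.update τ jj (Pol M T Q (x jj) (x' L - w x' - τ L)))) =
        fun x' => H (x', Function.update τ jj (T 0 (x jj) +
          spol (fun m : Fin (M + 1) => if (m : ℕ) = 0 then 0 else
            T m (x jj) / ((m : ℕ).factorial : ℝ)) (x' L - w x' - (τ L + Q (x jj))))) +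
          spol (0 : Fin (M + 1) → ℝ) (x' L - w x' - (τ L + Q (x jj))) • (0 : Vec ℓ) := by
      funext x'
      rw [smul_zero, add_zero, Pol_spol', ← sub_sub]
    simp only
    rw [e1]
    have a1 := wb x
    have a2 := (Qb (x jj)).trans (min_le_left _ _)
    have a3 := (Tb (x jj)).trans (min_le_right _ _)
    have a4 := w'b x
    have b1 := hsoft i hi x τ (T 0 (x jj)) (τ L + Q (x jj))
      (fun m : Fin (M + 1) => if (m : ℕ) = 0 then 0 else T m (x jj) / ((m : ℕ).factorial : ℝ)) 0
      (by
        rw [pi_norm_le_iff_of_nonneg (by positivity)]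
        intro l
        by_cases hl : l = L
        · rw [hl]
          simp only [Pi.sub_apply, Real.norm_eq_abs]
          have : x L - τ L = w' x := by linarith
          rw [this]; linarith
        · exact (hx l hl).trans (by linarith))
      (by linarith)
      (by
        have : τ L + Q (x jj) - x L = - w x := by simp only [hw'] at hxL; linarith
        rw [this, abs_neg]; linarith)
      (by
        intro m
        by_cases hm : (m : ℕ) = 0
        · simp [hm, hη.le]
        · simp only [hm, if_false]
          exact coef_small _ ((Tmb m (by omega) (by omega) _).trans (min_le_left _ _)))
      (by intro m; simp [hη.le])
    have b2 := Hap i hi x (Function.update τ jj (T 0 (x jj)))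
      (by
        intro l hl
        by_cases h : l = jj
        · subst h; rw [Function.update_self, abs_sub_comm]; exact a3
        · rw [Function.update_of_ne h]; exact hx l hl)
      (by
        rw [Function.update_of_ne (Ne.symm hne)]
        have : x L - w x - τ L = Q (x jj) := by simp only [hw'] at hxL; linarith
        rw [this]; exact a2)
    refine (norm_sub_le_norm_sub_add_norm_sub _ _ _).trans_lt ((add_lt_add b1 b2).trans_eq (by ring))
  -- tube
  have ht : ∃ δ' > 0, ∀ i ≤ r, ∀ x τ τ', ‖x - τ‖ ≤ δ + ε → ‖τ' - τ‖ ≤ δ' →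
      ‖iteratedFDeriv ℝ i (fun x => H' (x, τ')) x - iteratedFDeriv ℝ i (fun x => H' (x, τ)) x‖ <
        ε / 3 := by
    refine common_delta (Pr := fun i δ' => ∀ x τ τ', ‖x - τ‖ ≤ δ + ε → ‖τ' - τ‖ ≤ δ' →
      ‖iteratedFDeriv ℝ i (fun x => H' (x, τ')) x - iteratedFDeriv ℝ i (fun x => H' (x, τ)) x‖ <
        ε / 3) r (fun i d d' hd h x τ τ' h1 h2 => h x τ τ' h1 (h2.trans hd)) ?_
    intro i hi
    have sm := pD_smooth (f := fun z : Vec (k + 1) × Vec (k + 1) => H' (z.2, z.1))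
      (sH'.comp (contDiff_snd.prodMk contDiff_fst)) i
    exact UC (f := fun z : Vec (k + 1) × Vec (k + 1) => iteratedFDeriv ℝ i (fun x => H' (x, z.2)) z.1)
      (sm.continuous.comp (g := fun z : Vec (k + 1) × Vec (k + 1) =>
        iteratedFDeriv ℝ i (fun x => H' (x, z.1)) z.2) (continuous_snd.prodMk continuous_fst))
      (fun m x τ => iter_shift (fun x' => Hper' m x' τ) i x) (δ + ε) (ε / 3) (by positivity)
  obtain ⟨δ', hδ', htube⟩ := ht
  refine ⟨w', min δ δ', H', sw', sH', by positivity, w'per, ?_, fun x => (w'b x).trans (by linarith),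
    Hper', ?_, ?_⟩
  · intro x a
    simp only [hw', wlast, Function.update_of_ne hne]
  · intro x τ τ' h
    simp only [hH']
    have hLL : τ L = τ' L := h L (by simp [hL]; omega)
    rw [hLL]
    refine Hind _ _ _ fun i hi => ?_
    by_cases h' : i = jj
    · subst h'; simp
    · rw [Function.update_of_ne h', Function.update_of_ne h']
      refine h i ?_
      have : i.val ≠ j := fun h2 => h' (Fin.ext h2)
      omega
  · intro i hi x τ hx hxL
    have b1 := exact_est i hi x (Function.update τ L (x L - w' x))
      (fun l hl => by rw [Function.update_of_ne hl]; exact (hx l hl).trans (min_le_left _ _))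
      (by simp)
    have b2 := htube i hi x (Function.update τ L (x L - w' x)) τ
      (by
        rw [pi_norm_le_iff_of_nonneg (by positivity)]
        intro l
        have := w'b x
        by_cases hl : l = L
        · subst hl; simp; linarith
        · simp only [Pi.sub_apply, Function.update_of_ne hl, Real.norm_eq_abs]
          exact ((hx l hl).trans (min_le_left _ _)).trans (by linarith))
      (by
        rw [pi_norm_le_iff_of_nonneg (by positivity)]
        intro l
        by_cases hl : l = L
        · subst hl
          simp only [Pi.sub_apply, Function.update_self, Real.norm_eq_abs]
          rw [abs_sub_comm]; exact hxL.trans (min_le_right _ _)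
        · simp [Function.update_of_ne hl, hδ'.le])
    refine (norm_sub_le_norm_sub_add_norm_sub _ _ _).trans_lt ((add_lt_add b2 b1).trans_eq (by ring))

theorem smoothing {n ℓ i : ℕ} {s : Vec n → SymMap n ℓ i} (hc : Continuous s)
    (hp : ∀ m x, s (x + zcast m) = s x) (hs : ∀ x, IsSymmMap (s x)) (ε : ℝ) (hε : 0 < ε) :
    ∃ g : Vec n → SymMap n ℓ i, ContDiff ℝ ∞ g ∧ (∀ m x, g (x + zcast m) = g x) ∧
      (∀ x, IsSymmMap (g x)) ∧ ∀ x, ‖g x - s x‖ < ε := by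
  obtain ⟨δ, hδ, h⟩ := UC1 hc hp (ε / 2) (by positivity)
  let φ : ContDiffBump (0 : Vec n) := ⟨δ / 2, δ, by positivity, by linarith⟩
  let μ : MeasureTheory.Measure (Vec n) := MeasureTheory.volume
  let g : Vec n → SymMap n ℓ i :=
    MeasureTheory.convolution (φ.normed μ) s (ContinuousLinearMap.lsmul ℝ ℝ) μ
  have hg : ∀ x, g x = ∫ t, φ.normed μ t • s (x - t) ∂μ := fun x => rfl
  have hli : MeasureTheory.LocallyIntegrable s μ := hc.locallyIntegrable
  refine ⟨g, ?_, ?_, ?_, ?_⟩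
  · exact HasCompactSupport.contDiff_convolution_left (n := ⊤) _ φ.hasCompactSupport_normed
      φ.contDiff_normed hli
  · intro m x
    simp only [hg]
    congr 1; funext t
    rw [show x + zcast m - t = (x - t) + zcast m by abel, hp]
  · intro x e v
    have hint : MeasureTheory.Integrable (fun t => φ.normed μ t • s (x - t)) μ :=
      HasCompactSupport.convolutionExists_left (ContinuousLinearMap.lsmul ℝ ℝ)
        φ.hasCompactSupport_normed (φ.contDiff_normed (n := 0)).continuous hli x
    rw [hg, ContinuousMultilinearMap.integral_apply hint, ContinuousMultilinearMap.integral_apply hint]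
    congr 1; funext t
    simp only [smul_apply, hs (x - t) e v]
  · intro x
    rw [← dist_eq_norm]
    refine (ContDiffBump.dist_normed_convolution_le (φ := φ) (μ := μ) (g := s) (ε := ε / 2)
      hc.aestronglyMeasurable ?_).trans_lt (by linarith)
    intro y hy
    rw [dist_eq_norm]
    rw [Metric.mem_ball, dist_eq_norm] at hy
    exact (h x y hy.le).le

theorem diag_smooth {E V : Type*} [NormedAddCommGroup E] [NormedSpace ℝ E]
    [NormedAddCommGroup V] [NormedSpace ℝ V] (i : ℕ) :
    ContDiff ℝ ∞ (fun z : ContinuousMultilinearMap ℝ (fun _ : Fin i => E) V × E =>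
      z.1 (fun _ => z.2)) := by
  induction i with
  | zero =>
    have : (fun z : ContinuousMultilinearMap ℝ (fun _ : Fin 0 => E) V × E =>
      z.1 (fun _ => z.2)) = fun z => continuousMultilinearCurryFin0 ℝ E V z.1 := by
      funext z
      simp only [continuousMultilinearCurryFin0_apply]
      congr 1; funext j; exact j.elim0
    rw [this]
    exact (continuousMultilinearCurryFin0 ℝ E V).contDiff.comp contDiff_fst
  | succ i ih =>
    have : (fun z : ContinuousMultilinearMap ℝ (fun _ : Fin (i + 1) => E) V × E =>
      z.1 (fun _ => z.2)) = fun z => ((cL E V i).symm z.1 z.2) (fun _ => z.2) := by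
      funext z
      simp only [cL, LinearIsometryEquiv.symm_symm, continuousMultilinearCurryLeftEquiv_apply]
      congr 1; funext j
      refine Fin.cases ?_ (fun j => ?_) j <;> simp
    rw [this]
    exact ih.comp (((((cL E V i).symm.contDiff.comp contDiff_fst)).clm_apply contDiff_snd).prodMk
      contDiff_snd)

theorem taylor_jet {n ℓ : ℕ} (r : ℕ) (A : (i : ℕ) → SymMap n ℓ i)
    (hs : ∀ i ≤ r, IsSymmMap (A i)) (i : ℕ) (hi : i ≤ r) (τ : Vec n) :
    iteratedFDeriv ℝ i (fun x => ∑ j ∈ Finset.range (r + 1),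
      ((j.factorial : ℝ)⁻¹) • A j (fun _ => x - τ)) τ = A i := by
  let p : FormalMultilinearSeries ℝ (Vec n) (Vec ℓ) := fun j =>
    if j ≤ r then ((j.factorial : ℝ)⁻¹) • A j else 0
  have hp : HasFiniteFPowerSeriesOnBall (fun x => ∑ j ∈ Finset.range (r + 1),
      ((j.factorial : ℝ)⁻¹) • A j (fun _ => x - τ)) p τ (r + 1) ⊤ := by
    refine HasFiniteFPowerSeriesOnBall.mk' ?_ (by simp) ?_
    · intro m hm
      simp only [p]; rw [if_neg (by omega)]
    · intro y _
      refine Finset.sum_congr rfl fun j hj => ?_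
      rw [Finset.mem_range] at hj
      simp only [p]; rw [if_pos (by omega)]
      simp
  ext1 v
  rw [hp.toHasFPowerSeriesOnBall.iteratedFDeriv_eq_sum_of_completeSpace v]
  have : ∀ e : Equiv.Perm (Fin i), p i (fun l => v (e l)) = ((i.factorial : ℝ)⁻¹) • A i v := by
    intro e
    simp only [p]; rw [if_pos hi]
    simp only [smul_apply]
    congr 1
    exact hs i hi e v
  simp only [this, Finset.sum_const, Finset.card_univ, Fintype.card_perm, Fintype.card_fin]
  rw [← Nat.cast_smul_eq_nsmul ℝ, smul_smul, mul_inv_cancel₀ (by positivity), one_smul]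

theorem stage_zero {k ℓ r : ℕ} {σ : (i : ℕ) → Vec (k + 1) → SymMap (k + 1) ℓ i}
    (hc : ∀ i ≤ r, Continuous (σ i)) (hp : ∀ i ≤ r, ∀ m p, σ i (p + zcast m) = σ i p)
    (hs : ∀ i ≤ r, ∀ p, IsSymmMap (σ i p)) : Stage k ℓ r 0 σ := by
  intro ε hε
  have h : ∀ i, ∃ g : Vec (k + 1) → SymMap (k + 1) ℓ i, i ≤ r → (ContDiff ℝ ∞ g ∧
      (∀ m x, g (x + zcast m) = g x) ∧ (∀ x, IsSymmMap (g x)) ∧ ∀ x, ‖g x - σ i x‖ < ε / 2) := by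
    intro i
    by_cases hi : i ≤ r
    · obtain ⟨g, h⟩ := smoothing (hc i hi) (hp i hi) (hs i hi) (ε / 2) (by positivity)
      exact ⟨g, fun _ => h⟩
    · exact ⟨0, fun h => absurd h hi⟩
  choose g hg using h
  let H : Vec (k + 1) × Vec (k + 1) → Vec ℓ := fun z => ∑ j ∈ Finset.range (r + 1),
      ((j.factorial : ℝ)⁻¹) • g j z.2 (fun _ => z.1 - z.2)
  have sH : ContDiff ℝ ∞ H := by
    refine ContDiff.sum fun j hj => ?_
    rw [Finset.mem_range] at hj
    refine ContDiff.const_smul _ ?_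
    exact (diag_smooth j).comp ((((hg j (by omega)).1).comp contDiff_snd).prodMk
      (contDiff_fst.sub contDiff_snd))
  have Hper : ∀ m x τ, H (x + zcast m, τ + zcast m) = H (x, τ) := by
    intro m x τ
    refine Finset.sum_congr rfl fun j hj => ?_
    rw [Finset.mem_range] at hj
    simp only [(hg j (by omega)).2.1, add_sub_add_right_eq_sub]
  have Hjet : ∀ i ≤ r, ∀ x, iteratedFDeriv ℝ i (fun y => H (y, x)) x = g i x := fun i hi x =>
    taylor_jet r (fun i => g i x) (fun i hi => (hg i hi).2.2.1 x) i hi x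
  have ht : ∃ δ' > 0, ∀ i ≤ r, ∀ x τ, ‖τ - x‖ ≤ δ' →
      ‖iteratedFDeriv ℝ i (fun y => H (y, τ)) x - iteratedFDeriv ℝ i (fun y => H (y, x)) x‖ <
        ε / 2 := by
    refine common_delta (Pr := fun i δ' => ∀ x τ, ‖τ - x‖ ≤ δ' →
      ‖iteratedFDeriv ℝ i (fun y => H (y, τ)) x - iteratedFDeriv ℝ i (fun y => H (y, x)) x‖ <
        ε / 2) r (fun i d d' hd h x τ h2 => h x τ (h2.trans hd)) ?_
    intro i hi
    have sm := pD_smooth (f := fun z : Vec (k + 1) × Vec (k + 1) => H (z.2, z.1))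
      (sH.comp (contDiff_snd.prodMk contDiff_fst)) i
    obtain ⟨δ, h0, h⟩ := UC (f := fun z : Vec (k + 1) × Vec (k + 1) =>
        iteratedFDeriv ℝ i (fun x => H (x, z.2)) z.1)
      (sm.continuous.comp (g := fun z : Vec (k + 1) × Vec (k + 1) =>
        iteratedFDeriv ℝ i (fun x => H (x, z.1)) z.2) (continuous_snd.prodMk continuous_fst))
      (fun m x τ => iter_shift (fun x' => Hper m x' τ) i x) 0 (ε / 2) (by positivity)
    exact ⟨δ, h0, fun x τ hd => h x x τ (by simp) hd⟩
  obtain ⟨δ, hδ, hδ'⟩ := ht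
  refine ⟨0, δ, H, contDiff_const, sH, hδ, fun _ _ => rfl, fun _ _ => rfl, fun _ => by simp [hε.le],
    Hper, ?_, ?_⟩
  · intro x τ τ' h
    rw [show τ = τ' from funext fun i => h i (Nat.zero_le _)]
  · intro i hi x τ h1 h2
    have b1 := hδ' i hi x τ (by
      rw [pi_norm_le_iff_of_nonneg hδ.le]
      intro l
      rw [Pi.sub_apply, Real.norm_eq_abs, abs_sub_comm]
      by_cases hl : l = Fin.last k
      · subst hl; simpa using h2
      · exact h1 l hl)
    rw [Hjet i hi] at b1
    have b2 := (hg i hi).2.2.2 x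
    exact (norm_sub_le_norm_sub_add_norm_sub _ _ _).trans_lt ((add_lt_add b1 b2).trans_eq (by ring))

theorem stage_all {k ℓ r : ℕ} {σ : (i : ℕ) → Vec (k + 1) → SymMap (k + 1) ℓ i}
    (hc : ∀ i ≤ r, Continuous (σ i)) (hp : ∀ i ≤ r, ∀ m p, σ i (p + zcast m) = σ i p)
    (hs : ∀ i ≤ r, ∀ p, IsSymmMap (σ i p)) (j : ℕ) (hj : j ≤ k) : Stage k ℓ r j σ := by
  induction j with
  | zero => exact stage_zero hc hp hs
  | succ j ih => exact stage_step (by omega) (ih (by omega))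

section symm
variable {E V : Type*} [NormedAddCommGroup E] [NormedSpace ℝ E]
  [NormedAddCommGroup V] [NormedSpace ℝ V]

theorem iter_smooth {f : E → V} (hf : ContDiff ℝ ∞ f) (i : ℕ) :
    ContDiff ℝ ∞ (iteratedFDeriv ℝ i f) :=
  (pD_smooth (P := ℝ) (f := fun z => f z.2) (hf.comp contDiff_snd) i).comp
    ((contDiff_const (c := (0 : ℝ))).prodMk contDiff_id)

theorem cL_apply (i : ℕ) (L : E →L[ℝ] ContinuousMultilinearMap ℝ (fun _ : Fin i => E) V)
    (v : Fin (i + 1) → E) : cL E V i L v = L (v 0) (fun j => v j.succ) := rfl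

theorem iter_symm {f : E → V} (hf : ContDiff ℝ ∞ f) (i : ℕ) (x : E) (e : Equiv.Perm (Fin i))
    (v : Fin i → E) : iteratedFDeriv ℝ i f x (v ∘ e) = iteratedFDeriv ℝ i f x v := by
  induction i generalizing x with
  | zero =>
    congr 1; funext j; exact j.elim0
  | succ i ih =>
    have key : ∀ (j : Fin i) (v : Fin (i + 1) → E),
        iteratedFDeriv ℝ (i + 1) f x (v ∘ Equiv.swap j.castSucc j.succ) =
          iteratedFDeriv ℝ (i + 1) f x v := by
      intro j v
      cases i with
      | zero => exact j.elim0
      | succ i =>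
        refine Fin.cases ?_ (fun j => ?_) j
        · have s2 : ContDiff ℝ ∞ (fderiv ℝ (iteratedFDeriv ℝ i f)) :=
            (iter_smooth hf i).fderiv_right (by simp)
          have d2 : HasFDerivAt (fderiv ℝ (iteratedFDeriv ℝ i f))
            (fderiv ℝ (fderiv ℝ (iteratedFDeriv ℝ i f)) x) x :=
            (s2.differentiable (by simp)).differentiableAt.hasFDerivAt
          have d3 : fderiv ℝ (iteratedFDeriv ℝ (i + 1) f) x =
            ((cL E V i).toContinuousLinearEquiv.toContinuousLinearMap).comp
              (fderiv ℝ (fderiv ℝ (iteratedFDeriv ℝ i f)) x) :=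
            (((cL E V i).toContinuousLinearEquiv.toContinuousLinearMap.hasFDerivAt).comp x d2).fderiv
          have h : ∀ u : Fin (i + 1 + 1) → E, iteratedFDeriv ℝ (i + 1 + 1) f x u =
              fderiv ℝ (fderiv ℝ (iteratedFDeriv ℝ i f)) x (u 0) (u 1)
                (fun j => u j.succ.succ) := by
            intro u
            rw [iter_succ, cL_apply, d3]
            rfl
          have sym := ((iter_smooth hf i).contDiffAt (x := x)).isSymmSndFDerivAt
            (by simpa using WithTop.coe_le_coe.2 (le_top : (2 : ℕ∞) ≤ ⊤))
          rw [h, h]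
          simp only [Function.comp_apply, Fin.castSucc_zero, Fin.succ_zero_eq_one,
            Equiv.swap_apply_left, Equiv.swap_apply_right]
          rw [sym.eq]
          rfl
        · have h : ∀ (e' : Equiv.Perm (Fin (i + 1))) (a : E) (u : Fin (i + 1) → E),
              fderiv ℝ (iteratedFDeriv ℝ (i + 1) f) x a (u ∘ e') =
                fderiv ℝ (iteratedFDeriv ℝ (i + 1) f) x a u := by
            intro e' a u
            have d : HasFDerivAt (iteratedFDeriv ℝ (i + 1) f)
              (fderiv ℝ (iteratedFDeriv ℝ (i + 1) f) x) x :=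
              ((iter_smooth hf (i + 1)).differentiable (by simp)).differentiableAt.hasFDerivAt
            have h1 := d.continuousMultilinear_apply_const (u ∘ e')
            have h2 := d.continuousMultilinear_apply_const u
            have e : (fun y => iteratedFDeriv ℝ (i + 1) f y (u ∘ e')) =
              fun y => iteratedFDeriv ℝ (i + 1) f y u := funext fun y => ih y e' u
            rw [e] at h1
            have := congrArg (fun L => L a) (h1.unique h2)
            exact this
          rw [iter_succ, cL_apply, cL_apply]
          have h0 : (v ∘ Equiv.swap j.succ.castSucc j.succ.succ) 0 = v 0 := by
            rw [Function.comp_apply, Equiv.swap_apply_of_ne_of_ne (Ne.symm ?_)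
              (Ne.symm (Fin.succ_ne_zero _))]
            rw [← Fin.succ_castSucc]; exact Fin.succ_ne_zero _
          have h1 : (fun l : Fin (i + 1) => (v ∘ Equiv.swap j.succ.castSucc j.succ.succ) l.succ) =
              (fun l => v l.succ) ∘ Equiv.swap j.castSucc j.succ := by
            funext l
            simp only [Function.comp_apply]
            rw [← Fin.succ_castSucc]
            congr 1
            simp only [Equiv.swap_apply_def, Fin.succ_inj]
            split_ifs <;> rfl
          rw [h0, h1, h]
    have htop : e ∈ Submonoid.closure (Set.range fun j : Fin i => Equiv.swap j.castSucc j.succ) := by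
      rw [Equiv.Perm.mclosure_swap_castSucc_succ]; trivial
    induction htop using Submonoid.closure_induction generalizing v with
    | mem e he =>
      obtain ⟨j, rfl⟩ := he
      exact key j v
    | one => rfl
    | mul e1 e2 _ _ h1 h2 =>
      have : v ∘ (e1 * e2 : Equiv.Perm (Fin (i + 1))) = (v ∘ e1) ∘ e2 := rfl
      rw [this, h2, h1]
end symm

theorem lip {k : ℕ} {V : Type*} [NormedAddCommGroup V] [NormedSpace ℝ V]
    {h : Vec (k + 1) × ℝ → V} (sh : ContDiff ℝ ∞ h)
    (hp : ∀ m x a, h (x + zcast m, a + m (Fin.last k)) = h (x, a)) (R : ℝ) :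
    ∃ C, 0 ≤ C ∧ ∀ x a a', |a - x (Fin.last k)| ≤ R → |a' - x (Fin.last k)| ≤ R →
      ‖h (x, a) - h (x, a')‖ ≤ C * |a - a'| := by
  have sd : ContDiff ℝ ∞ (fderiv ℝ h) := sh.fderiv_right (by simp)
  obtain ⟨C, hC⟩ := ((isCompact_closedBall (0 : Vec (k + 1)) 1).prod
    (isCompact_closedBall (0 : ℝ) (R + 1))).exists_bound_of_continuousOn sd.continuous.continuousOn
  refine ⟨max C 0, le_max_right _ _, fun x a a' h1 h2 => ?_⟩
  rw [← hp (flv x) x a, ← hp (flv x) x a']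
  have f1 := flv_norm x
  have f3 := flv_norm_apply x (Fin.last k)
  have hm : ∀ b, |b - x (Fin.last k)| ≤ R → (x + zcast (flv x), b + (flv x (Fin.last k) : ℝ)) ∈
      Metric.closedBall (0 : Vec (k + 1)) 1 ×ˢ Metric.closedBall (0 : ℝ) (R + 1) := by
    intro b hb
    simp only [Set.mem_prod, mem_closedBall_zero_iff, Real.norm_eq_abs]
    refine ⟨f1, ?_⟩
    rw [abs_le] at *
    constructor <;> linarith
  have := Convex.norm_image_sub_le_of_norm_fderiv_le (𝕜 := ℝ) (C := max C 0)
    (fun z _ => (sh.differentiable (by simp)).differentiableAt)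
    (fun z hz => (hC z hz).trans (le_max_left _ _))
    ((convex_closedBall (0 : Vec (k + 1)) 1).prod (convex_closedBall (0 : ℝ) (R + 1)))
    (hm a' h2) (hm a h1)
  refine this.trans (le_of_eq ?_)
  congr 1
  rw [Prod.mk_sub_mk, sub_self, add_sub_add_right_eq_sub, Prod.norm_def]
  simp

theorem Pol_self (M : ℕ) (T : ℕ → ℝ → ℝ) (Q : ℝ → ℝ) (t : ℝ) : Pol M T Q t (Q t) = T 0 t := by
  simp only [Pol, sub_self]
  rw [Finset.sum_range_succ']
  simp

theorem bij_fderiv {k : ℕ} {w : Vec (k + 1) → ℝ} {Q : ℝ → ℝ}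
    (wlast : ∀ x a, w (Function.update x (Fin.last k) a) = w x) (sQ : ContDiff ℝ ∞ Q)
    {X : Vec (k + 1) → Vec (k + 1)} (sX : ContDiff ℝ ∞ X)
    (hX : ∀ p, X p = Function.update p (Fin.last k) (Q (p (Fin.last k)) + w p))
    (p : Vec (k + 1)) (h : deriv Q (p (Fin.last k)) ≠ 0) :
    Function.Bijective ⇑(fderiv ℝ X p) := by
  set L := Fin.last k with hL
  have dX : HasFDerivAt X (fderiv ℝ X p) p :=
    (sX.differentiable (by simp)).differentiableAt.hasFDerivAt
  have c1 : ∀ l, l ≠ L → ∀ v, fderiv ℝ X p v l = v l := by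
    intro l hl v
    have h1 := (hasFDerivAt_pi'.1 dX) l
    have e : (fun x => X x l) = fun x => x l := by
      funext x; rw [hX, Function.update_of_ne hl]
    rw [e] at h1
    have h2 := (ContinuousLinearMap.proj (R := ℝ) (φ := fun _ : Fin (k + 1) => ℝ) l).hasFDerivAt
      (x := p)
    have := congrArg (fun A => A v) (h1.unique h2)
    exact this
  have c2 : fderiv ℝ X p (Pi.single L 1) = deriv Q (p L) • Pi.single L 1 := by
    have dX' : HasFDerivAt X (fderiv ℝ X p) (Function.update p L (p L)) := by
      rwa [Function.update_eq_self]
    have h1 := HasFDerivAt.comp_hasDerivAt (l := X) (f := Function.update p L) (p L) dX'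
      (hasDerivAt_update p L (p L))
    have e : X ∘ Function.update p L = fun s => Function.update p L (Q s + w p) := by
      funext s
      rw [Function.comp_apply, hX, wlast]
      simp
    rw [e] at h1
    have dQ : HasDerivAt Q (deriv Q (p L)) (p L) :=
      (sQ.differentiable (by simp)).differentiableAt.hasDerivAt
    have h2 := HasDerivAt.scomp (p L) (hasDerivAt_update p L (Q (p L) + w p)) (dQ.add_const (w p))
    exact h1.unique h2
  have inj : Function.Injective (fderiv ℝ X p) := by
    rw [injective_iff_map_eq_zero]
    intro v hv
    have hv' : v = v L • Pi.single L (1 : ℝ) := by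
      funext l
      by_cases hl : l = L
      · subst hl; simp
      · rw [← c1 l hl v, hv]; simp [hl]
    have h3 : (v L * deriv Q (p L)) = 0 := by
      have := congrFun hv L
      rw [hv', map_smul, c2] at this
      simpa using this
    rw [hv', (mul_eq_zero.1 h3).resolve_right h, zero_smul]
  exact ⟨inj, (LinearMap.injective_iff_surjective (f := (fderiv ℝ X p).toLinearMap)).1 inj⟩

theorem integ {E V : Type*} [NormedAddCommGroup E] [NormedSpace ℝ E]
    [NormedAddCommGroup V] [NormedSpace ℝ V] {f : ℝ × E → V} (hf : ContDiff ℝ ∞ f) {X : E → E}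
    (sX : ContDiff ℝ ∞ X) {c : E → ℝ} (sc : ContDiff ℝ ∞ c) (i : ℕ) (p v : E)
    (h0 : HasDerivAt (fun t => iteratedFDeriv ℝ i (fun x => f (t, x)) (X p)) 0 (c p))
    (u : Fin i → E) :
    fderiv ℝ (fun p => iteratedFDeriv ℝ i (fun x => f (c p, x)) (X p)) p v u =
      iteratedFDeriv ℝ (i + 1) (fun x => f (c p, x)) (X p) (Fin.cons (fderiv ℝ X p v) u) := by
  set g : ℝ × E → ContinuousMultilinearMap ℝ (fun _ : Fin i => E) V :=
      fun z => iteratedFDeriv ℝ i (fun x => f (z.1, x)) z.2 with hg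
  have sg : ContDiff ℝ ∞ g := pD_smooth hf i
  have dg : HasFDerivAt g (fderiv ℝ g (c p, X p)) (c p, X p) :=
    (sg.differentiable (by simp)).differentiableAt.hasFDerivAt
  set D := fderiv ℝ g (c p, X p) with hD
  have dX : HasFDerivAt X (fderiv ℝ X p) p :=
    (sX.differentiable (by simp)).differentiableAt.hasFDerivAt
  have dc : HasFDerivAt c (fderiv ℝ c p) p :=
    (sc.differentiable (by simp)).differentiableAt.hasFDerivAt
  have h1 : D (1, 0) = 0 :=
    (HasFDerivAt.comp_hasDerivAt (l := g) (f := fun t => (t, X p)) (c p) dg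
      ((hasDerivAt_id (c p)).prodMk (hasDerivAt_const (c p) (X p)))).unique h0
  have h2 : fderiv ℝ (iteratedFDeriv ℝ i fun x' => f (c p, x')) (X p) =
      D.comp (ContinuousLinearMap.inr ℝ ℝ E) :=
    (HasFDerivAt.comp (g := g) (f := fun x => (c p, x)) (X p) dg
      (hasFDerivAt_prodMk_right (c p) (X p))).fderiv
  have h3 : HasFDerivAt (fun p => iteratedFDeriv ℝ i (fun x => f (c p, x)) (X p))
      (D.comp ((fderiv ℝ c p).prod (fderiv ℝ X p))) p :=
    HasFDerivAt.comp (g := g) (f := fun p => (c p, X p)) p dg (dc.prodMk dX)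
  rw [h3.fderiv, iter_succ, cL_apply, h2]
  have h4 : D (fderiv ℝ c p v, fderiv ℝ X p v) =
      fderiv ℝ c p v • D (1, 0) + D (0, fderiv ℝ X p v) := by
    rw [← map_smul, ← map_add]; simp
  simp only [ContinuousLinearMap.comp_apply, ContinuousLinearMap.prod_apply, h4, h1, smul_zero,
    zero_add, Fin.cons_zero, Fin.cons_succ, ContinuousLinearMap.inr_apply]

set_option maxHeartbeats 2000000 in
theorem main_succ (k ℓ r : ℕ) (hℓ : 1 ≤ ℓ) (ε : ℝ) (hε : 0 < ε)
    (σ : (i : ℕ) → Vec (k + 1) → SymMap (k + 1) ℓ i)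
    (hc : ∀ i ≤ r, Continuous (σ i)) (hp : ∀ i ≤ r, ∀ m p, σ i (p + zcast m) = σ i p)
    (hs : ∀ i ≤ r, ∀ p, IsSymmMap (σ i p)) :
    ∃ (X : Vec (k + 1) → Vec (k + 1)) (ζ : (i : ℕ) → Vec (k + 1) → SymMap (k + 1) ℓ i),
      ContDiff ℝ (⊤ : ℕ∞) X ∧ (∀ i ≤ r, ContDiff ℝ (⊤ : ℕ∞) (ζ i)) ∧
      (∀ i ≤ r, ∀ p : Vec (k + 1), IsSymmMap (ζ i p)) ∧
      (∀ (m : Fin (k + 1) → ℤ) (p : Vec (k + 1)), X (p + zcast m) = X p + zcast m) ∧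
      (∀ i ≤ r, ∀ (m : Fin (k + 1) → ℤ) (p : Vec (k + 1)), ζ i (p + zcast m) = ζ i p) ∧
      (∀ i < r, ∀ (p v : Vec (k + 1)) (w : Fin i → Vec (k + 1)),
        (fderiv ℝ (ζ i) p v) w = ζ (i + 1) p (Fin.cons (fderiv ℝ X p v) w)) ∧
      Dense {p : Vec (k + 1) | Function.Bijective ⇑(fderiv ℝ X p)} ∧
      (∀ (p q : Vec (k + 1)) (m : Fin (k + 1) → ℤ),
        X p = X q + zcast m → ζ 0 p = ζ 0 q → p = q + zcast m) ∧
      (∀ p : Vec (k + 1), ‖X p - p‖ < ε) ∧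
      (∀ i ≤ r, ∀ p : Vec (k + 1), ‖ζ i p - σ i p‖ < ε) := by
  obtain ⟨δu, hδu, hu⟩ : ∃ δ > 0, ∀ i ≤ r, ∀ x x', ‖x' - x‖ ≤ δ → ‖σ i x' - σ i x‖ < ε / 4 :=
    common_delta (Pr := fun i δ => ∀ x x', ‖x' - x‖ ≤ δ → ‖σ i x' - σ i x‖ < ε / 4) r
      (fun i d d' hd h x x' h2 => h x x' (h2.trans hd))
      (fun i hi => UC1 (hc i hi) (hp i hi) (ε / 4) (by positivity))
  obtain ⟨w, δ, H, sw, sH, hδ, wper, wlast, wb, Hper, Hind, Hap⟩ :=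
    stage_all hc hp hs k le_rfl (min (ε / 4) (δu / 2)) (by positivity)
  set L := Fin.last k with hL
  set M := r + 1 with hM
  have sL : ContDiff ℝ ∞ (fun x : Vec (k + 1) => x L) := contDiff_apply ℝ ℝ L
  -- the reduced function
  set h : Vec (k + 1) × ℝ → Vec ℓ := fun z => H (z.1, Function.update 0 L z.2) with hh
  have h_ind : ∀ x a τ, h (x, a) = H (x, Function.update τ L a) := by
    intro x a τ
    refine Hind _ _ _ fun i hi => ?_
    have : i = L := by apply Fin.ext; simp [hL]; omega
    subst this; simp
  have sh : ContDiff ℝ ∞ h :=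
    sH.comp (contDiff_fst.prodMk ((update_smooth L).comp (contDiff_const.prodMk contDiff_snd)))
  have hper : ∀ m x a, h (x + zcast m, a + m L) = h (x, a) := by
    intro m x a
    rw [h_ind _ _ (0 + zcast m), update_zcast, Hper]
  obtain ⟨C, hC, hlip⟩ := lip sh hper (δ + ε + 1)
  set e : Vec ℓ := Pi.single ⟨0, by omega⟩ 1 with he
  have he1 : ‖e‖ = 1 := by rw [he, Pi.norm_single]; simp
  obtain ⟨η, hη, hsoft⟩ := soft r M sH Hper sw wper L e (δ + ε + 1) (ε / 4) (by positivity)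
  obtain ⟨Q, T, S, sQ, hT, hS, Qper, Tper, Sper, Qb, Tb, S0b, Tmb, Smb, Qd, hsep⟩ :=
    zig M C η (min (δ / 2) (min (δu / 2) (ε / 4))) hC hη (by positivity)
  set q : Vec (k + 1) → ℝ := fun x => x L - w x with hq
  have sq : ContDiff ℝ ∞ q := sL.sub sw
  obtain ⟨sf, sl, G, sG, hG⟩ := flat_comp hT hS sQ
    (A := fun z : Vec (k + 1) × ℝ × ℝ => h (z.1, z.2.1) + z.2.2 • e)
    ((sh.comp (contDiff_fst.prodMk (contDiff_fst.comp contDiff_snd))).add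
      ((contDiff_snd.comp contDiff_snd).smul contDiff_const)) sq
  set f : ℝ × Vec (k + 1) → Vec ℓ := fun z =>
    h (z.2, Pol M T Q z.1 (q z.2)) + Pol M S Q z.1 (q z.2) • e with hf
  have sf' : ContDiff ℝ ∞ f := sf
  set X : Vec (k + 1) → Vec (k + 1) := fun p => Function.update p L (Q (p L) + w p) with hX
  have sX : ContDiff ℝ ∞ X :=
    (update_smooth L).comp (contDiff_id.prodMk ((sQ.comp sL).add sw))
  set ζ : (i : ℕ) → Vec (k + 1) → SymMap (k + 1) ℓ i := fun i p =>
    iteratedFDeriv ℝ i (fun x => f (p L, x)) (X p) with hζ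
  have wX : ∀ p, w (X p) = w p := fun p => wlast p _
  have XL : ∀ p, X p L = Q (p L) + w p := fun p => by simp [hX]
  have qX : ∀ p, q (X p) = Q (p L) := fun p => by simp only [hq]; rw [wX, XL]; ring
  have sfx : ∀ t, ContDiff ℝ ∞ (fun x => f (t, x)) := fun t =>
    sf'.comp (contDiff_const.prodMk contDiff_id)
  have Xper : ∀ (m : Fin (k + 1) → ℤ) (p : Vec (k + 1)), X (p + zcast m) = X p + zcast m := by
    intro m p
    simp only [hX]
    rw [wper]
    have : (p + zcast m) L = p L + (m L : ℝ) := rfl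
    rw [this, shift_int Qper, add_right_comm, update_zcast]
  have ζper : ∀ i, ∀ (m : Fin (k + 1) → ℤ) (p : Vec (k + 1)), ζ i (p + zcast m) = ζ i p := by
    intro i m p
    simp only [hζ]
    rw [Xper]
    refine iter_shift (fun x => ?_) i (X p)
    have e1 : (p + zcast m) L = p L + (m L : ℝ) := rfl
    have e2 : q (x + zcast m) = q x + (m L : ℝ) := by
      simp only [hq]; rw [wper]
      have : (x + zcast m) L = x L + (m L : ℝ) := rfl
      rw [this]; ring
    simp only [hf]
    rw [e1, e2]
    have hy : q x + (m L : ℝ) - Q (p L + (m L : ℝ)) = q x - Q (p L) := by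
      rw [shift_int Qper]; ring
    rw [Pol_shift hT (p L) (q x) _ _ (m L) (m L) rfl hy (shift_int Tper _ _),
      Pol_shift hS (p L) (q x) _ _ 0 (m L) rfl hy (by rw [per_int Sper, add_zero]), hper, add_zero]
  have Xp : ∀ p, ‖X p - p‖ ≤ min (δu / 2) (ε / 4) + min (ε / 4) (δu / 2) := by
    intro p
    rw [pi_norm_le_iff_of_nonneg (by positivity)]
    intro l
    by_cases hl : l = L
    · rw [hl, Pi.sub_apply, XL, Real.norm_eq_abs]
      have h1 := (Qb (p L)).trans (min_le_right _ _)
      have h2 := wb p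
      have : Q (p L) + w p - p L = (Q (p L) - p L) + w p := by ring
      rw [this]
      exact (abs_add_le _ _).trans (add_le_add h1 h2)
    · simp only [hX, Pi.sub_apply, Function.update_of_ne hl, sub_self, norm_zero]
      positivity
  have m1 : min (δu / 2) (ε / 4) ≤ δu / 2 := min_le_left _ _
  have m2 : min (δu / 2) (ε / 4) ≤ ε / 4 := min_le_right _ _
  have m3 : min (ε / 4) (δu / 2) ≤ ε / 4 := min_le_left _ _
  have m4 : min (ε / 4) (δu / 2) ≤ δu / 2 := min_le_right _ _
  have m5 : min (δ / 2) (min (δu / 2) (ε / 4)) ≤ δ / 2 := min_le_left _ _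
  have m6 : min (δ / 2) (min (δu / 2) (ε / 4)) ≤ ε / 4 := (min_le_right _ _).trans m2
  have TQ : ∀ t, |Q t - T 0 t| ≤ δ := fun t => by
    have h1 := Qb t
    have h2 := Tb t
    rw [abs_le] at *
    constructor <;> linarith
  have TX : ∀ p, |T 0 (p L) - X p L| ≤ δ + ε + 1 := fun p => by
    have h1 := TQ (p L)
    have h2 := wb p
    rw [XL]
    rw [abs_le] at *
    constructor <;> linarith
  have val : ∀ p, f (p L, X p) = h (X p, T 0 (p L)) + S 0 (p L) • e := fun p => by
    simp only [hf, qX, Pol_self]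
  have inj0 : ∀ p p', X p = X p' → ζ 0 p = ζ 0 p' → p = p' := by
    intro p p' h1 h2
    have c1 : ∀ l, l ≠ L → p l = p' l := fun l hl => by
      have := congrFun h1 l
      simpa only [hX, Function.update_of_ne hl] using this
    have e1 : p' = Function.update p L (p' L) := by
      funext l
      by_cases hl : l = L
      · subst hl; simp
      · rw [Function.update_of_ne hl, c1 l hl]
    have e2 : w p' = w p := by rw [e1, wlast]
    have e3 : Q (p L) = Q (p' L) := by
      have := congrFun h1 L
      rw [XL, XL, e2] at this
      linarith
    have e4 : p L = p' L := by
      by_contra hne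
      have h3 := hsep _ _ hne e3
      have h4 : f (p L, X p) = f (p' L, X p') := congrArg (fun A => A 0) h2
      rw [val, val, ← h1] at h4
      have h5 : h (X p, T 0 (p L)) - h (X p, T 0 (p' L)) = (S 0 (p' L) - S 0 (p L)) • e := by
        rw [sub_smul, sub_eq_sub_iff_add_eq_add, h4, add_comm]
      have h6 := hlip (X p) (T 0 (p L)) (T 0 (p' L)) (TX p) (by rw [h1]; exact TX p')
      rw [h5, norm_smul, he1, mul_one, Real.norm_eq_abs, abs_sub_comm] at h6
      linarith
    rw [e1, ← e4, Function.update_eq_self]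
  refine ⟨X, ζ, sX, ?_, ?_, Xper, fun i _ => ζper i, ?_, ?_, ?_, ?_, ?_⟩
  · intro i _
    exact (pD_smooth sf' i).comp (sL.prodMk sX)
  · intro i _ p e v
    exact iter_symm (sfx _) i _ e v
  · intro i hi p v u
    exact integ sf' sX sL i p v (flat_zero sf sl sG hG i (by omega) (p L) (X p) (by
      simp only [qX, sub_self])) u
  · have : Dense (Function.eval L ⁻¹' {t | deriv Q t ≠ 0} : Set (Vec (k + 1))) :=
      Qd.preimage (isOpenMap_eval (X := fun _ : Fin (k + 1) => ℝ) L)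
    refine this.mono fun p hp => ?_
    exact bij_fderiv wlast sQ sX (fun p => rfl) p hp
  · intro p p' m h1 h2
    refine inj0 p (p' + zcast m) ?_ ?_
    · rw [Xper]; exact h1
    · rw [ζper]; exact h2
  · intro p
    exact (Xp p).trans_lt (by linarith)
  · intro i hi p
    have e1 : (fun x => f (p L, x)) = fun x => H (x, Function.update (X p) L (T 0 (p L) +
          spol (fun m : Fin (M + 1) => if (m : ℕ) = 0 then 0 else
            T m (p L) / ((m : ℕ).factorial : ℝ)) (x L - w x - Q (p L)))) +
          spol (fun m : Fin (M + 1) => S m (p L) / ((m : ℕ).factorial : ℝ))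
            (x L - w x - Q (p L)) • e := by
      funext x
      simp only [hf]
      rw [Pol_spol', Pol_spol, h_ind _ _ (X p)]
    have b1 := hsoft i hi (X p) (X p) (T 0 (p L)) (Q (p L))
      (fun m : Fin (M + 1) => if (m : ℕ) = 0 then 0 else T m (p L) / ((m : ℕ).factorial : ℝ))
      (fun m : Fin (M + 1) => S m (p L) / ((m : ℕ).factorial : ℝ))
      (by rw [sub_self, norm_zero]; positivity) (TX p)
      (by
        rw [XL]
        have h2 := wb p
        rw [abs_le] at *
        constructor <;> linarith)
      (by
        intro m
        by_cases hm : (m : ℕ) = 0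
        · simp [hm, hη.le]
        · simp only [hm, if_false]
          exact coef_small _ (Tmb m (by omega) (by omega) _))
      (by
        intro m
        by_cases hm : (m : ℕ) = 0
        · rw [hm]; exact coef_small _ (S0b _)
        · exact coef_small _ (Smb m (by omega) (by omega) _))
    have b2 := Hap i hi (X p) (Function.update (X p) L (T 0 (p L)))
      (fun l hl => by rw [Function.update_of_ne hl, sub_self, abs_zero]; exact hδ.le)
      (by
        rw [Function.update_self, wX, XL, add_sub_cancel_right]
        exact TQ _)
    have b3 := hu i hi p (X p) ((Xp p).trans (by linarith))
    simp only [hζ]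
    rw [e1]
    refine (norm_sub_le_norm_sub_add_norm_sub _ (σ i (X p)) _).trans_lt ?_
    have b4 := (norm_sub_le_norm_sub_add_norm_sub _ _ (σ i (X p))).trans_lt (add_lt_add b1 b2)
    linarith

end helpers

/-- Holonomic approximation by multi-sections (del Pino–Toussaint, Theorem 7.2),
over the `n`-torus in standard coordinates. -/
theorem holonomic_approximation_by_multisections
    (n ℓ r : ℕ) (hn : 1 ≤ n) (hℓ : 1 ≤ ℓ) (hr : 1 ≤ r)
    (ε : ℝ) (hε : 0 < ε)
    (σ : (i : ℕ) → Vec n → SymMap n ℓ i)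
    (hσcont : ∀ i ≤ r, Continuous (σ i))
    (hσper : ∀ i ≤ r, ∀ (m : Fin n → ℤ) (p : Vec n), σ i (p + zcast m) = σ i p)
    (hσsym : ∀ i ≤ r, ∀ p : Vec n, IsSymmMap (σ i p)) :
    ∃ (X : Vec n → Vec n) (ζ : (i : ℕ) → Vec n → SymMap n ℓ i),
      -- the tuple consists of smooth maps into `Sym^i`
      ContDiff ℝ (⊤ : ℕ∞) X ∧ (∀ i ≤ r, ContDiff ℝ (⊤ : ℕ∞) (ζ i)) ∧
      (∀ i ≤ r, ∀ p : Vec n, IsSymmMap (ζ i p)) ∧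
      -- (a) ℤⁿ-equivariance
      (∀ (m : Fin n → ℤ) (p : Vec n), X (p + zcast m) = X p + zcast m) ∧
      (∀ i ≤ r, ∀ (m : Fin n → ℤ) (p : Vec n), ζ i (p + zcast m) = ζ i p) ∧
      -- (b) integrality
      (∀ i < r, ∀ (p v : Vec n) (w : Fin i → Vec n),
        (fderiv ℝ (ζ i) p v) w = ζ (i + 1) p (Fin.cons (fderiv ℝ X p v) w)) ∧
      -- (c) dense graphicality locus
      Dense {p : Vec n | Function.Bijective ⇑(fderiv ℝ X p)} ∧
      -- (d) the front is injective modulo ℤⁿ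
      (∀ (p q : Vec n) (m : Fin n → ℤ),
        X p = X q + zcast m → ζ 0 p = ζ 0 q → p = q + zcast m) ∧
      -- (e) approximation
      (∀ p : Vec n, ‖X p - p‖ < ε) ∧ (∀ i ≤ r, ∀ p : Vec n, ‖ζ i p - σ i p‖ < ε) := by
  obtain ⟨k, rfl⟩ : ∃ k, n = k + 1 := ⟨n - 1, by omega⟩
  exact main_succ k ℓ r hℓ ε hε σ hσcont hσper hσsym
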